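/- arXiv:2510.03972 — 5 statements merged into one kernel-verified Lean document; each statement's English description precedes it below -/
import Mathlib

section
/- Synchronization at the discrete level (precise form of Theorem 4.8). Let (uⁿ, vⁿ) solve the Gray–Scott scheme and (ũⁿ, ṽⁿ) solve the nudged scheme with observations 𝓘_H uⁿ, 𝓘_H vⁿ. Assume there is v_max ≥ 0 such that 0 ≤ uⁿ_K ≤ 1, 0 ≤ vⁿ_K ≤ v_max and 0 ≤ ṽⁿ_K ≤ v_max for all cells K and all n ≥ 0, and let γ₀ > 0 be a constant such that ‖w − 𝓘_H w‖_h² ≤ γ₀ H² ‖∇w‖_h² for every fine-grid function w. Set d̲ := min(d_u, d_v) and μ̄ := max(μ_u, μ_v), and suppose there exists ε > 1/4 such that d̲ ≥ ε μ̄ γ₀ H², Δt (2ε(F + k + μ̄) + C_NL) ≤ 1, and δ := min{(1 − 1/(4ε))(F + μ_u), (1 − 1/(4ε))(F + k + μ_v)} − C_NL > 0. Then, with eⁿ := ũⁿ − uⁿ and fⁿ := ṽⁿ − vⁿ, for every m ≥ 0 one has ‖e^m‖_h² + ‖f^m‖_h² ≤ (‖e⁰‖_h² + ‖f⁰‖_h²)(1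 + 2δΔt)^{−m} (exponential decay of the error), and moreover ‖e^m‖_h² + ‖f^m‖_h² + (1 − Δt(2ε(F + k + μ̄) + C_NL)) Σ_{n=1}^m (‖eⁿ − e^{n−1}‖_h² + ‖fⁿ − f^{n−1}‖_h²) + 2Δt(d̲ − ε μ̄ γ₀ H²) Σ_{n=1}^m (‖∇eⁿ‖_h² + ‖∇fⁿ‖_h²) ≤ ‖e⁰‖_h² + ‖f⁰‖_h². -/
/-- Discrete (cell) inner product on the uniform `N × N` grid with mesh size `h = 1/N`. -/
noncomputable def gridIP (N : ℕ) (w φ : Fin N × Fin N → ℝ) : ℝ :=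
  ((1 : ℝ) / N) ^ 2 * ∑ K : Fin N × Fin N, w K * φ K

/-- Discrete squared `L²` norm. -/
noncomputable def gridNormSq (N : ℕ) (w : Fin N × Fin N → ℝ) : ℝ := gridIP N w w

/-- Two cells are adjacent when their index pairs differ by `1` in exactly one coordinate. -/
def adjCells {N : ℕ} (K L : Fin N × Fin N) : Prop :=
  (K.1 = L.1 ∧ ((K.2 : ℕ) + 1 = (L.2 : ℕ) ∨ (L.2 : ℕ) + 1 = (K.2 : ℕ))) ∨
  (K.2 = L.2 ∧ ((K.1 : ℕ) + 1 = (L.1 : ℕ) ∨ (L.1 : ℕ) + 1 = (K.1 : ℕ)))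

instance {N : ℕ} (K L : Fin N × Fin N) : Decidable (adjCells K L) := by
  unfold adjCells; infer_instance

/-- Discrete gradient inner product: sum over unordered adjacent pairs `{K, L}` of
`(w_K − w_L)(φ_K − φ_L)`, written as half the sum over ordered pairs. -/
noncomputable def gridGradIP (N : ℕ) (w φ : Fin N × Fin N → ℝ) : ℝ :=
  (1 / 2 : ℝ) * ∑ K : Fin N × Fin N, ∑ L : Fin N × Fin N,
    if adjCells K L then (w K - w L) * (φ K - φ L) else 0

/-- Discrete squared `L²` norm of the gradient. -/
noncomputable def gridGradNormSq (N : ℕ) (w : Fin N × Fin N → ℝ) : ℝ := gridGradIP N w w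

/-- Block-average observation operator `𝓘_H` (blocks of `m × m` fine cells). -/
noncomputable def obsAvg (N m : ℕ) (w : Fin N × Fin N → ℝ) : Fin N × Fin N → ℝ :=
  fun K => (1 / (m : ℝ) ^ 2) * ∑ L : Fin N × Fin N,
    if ((L.1 : ℕ) / m = (K.1 : ℕ) / m ∧ (L.2 : ℕ) / m = (K.2 : ℕ) / m) then w L else 0

/-- The semi-implicit finite-volume Gray–Scott scheme (the "truth"). -/
def GrayScottScheme (N : ℕ) (du dv F k Δt : ℝ) (u v : ℕ → Fin N × Fin N → ℝ) : Prop :=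
  ∀ (n : ℕ) (φ : Fin N × Fin N → ℝ),
    (gridIP N (u (n + 1) - u n) φ + Δt * du * gridGradIP N (u (n + 1)) φ =
      Δt * gridIP N (fun K => -(u n K) * (v n K) ^ 2 + F * (1 - u n K)) φ) ∧
    (gridIP N (v (n + 1) - v n) φ + Δt * dv * gridGradIP N (v (n + 1)) φ =
      Δt * gridIP N (fun K => u n K * (v n K) ^ 2 - (F + k) * v n K) φ)

/-- The discrete nudged Gray–Scott scheme, with observations `𝓘_H uⁿ, 𝓘_H vⁿ`. -/
def NudgedScheme (N m : ℕ) (du dv F k Δt μu μv : ℝ)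
    (u v ut vt : ℕ → Fin N × Fin N → ℝ) : Prop :=
  ∀ (n : ℕ) (φ : Fin N × Fin N → ℝ),
    (gridIP N (ut (n + 1) - ut n) φ + Δt * du * gridGradIP N (ut (n + 1)) φ =
      Δt * gridIP N (fun K => -(ut n K) * (vt n K) ^ 2 + F * (1 - ut n K)
        + μu * (obsAvg N m (u n) K - obsAvg N m (ut n) K)) φ) ∧
    (gridIP N (vt (n + 1) - vt n) φ + Δt * dv * gridGradIP N (vt (n + 1)) φ =
      Δt * gridIP N (fun K => ut n K * (vt n K) ^ 2 - (F + k) * vt n K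
        + μv * (obsAvg N m (v n) K - obsAvg N m (vt n) K)) φ)

theorem gIP_comm (N : ℕ) (a b : Fin N × Fin N → ℝ) : gridIP N a b = gridIP N b a := by
  unfold gridIP
  congr 1
  exact Finset.sum_congr rfl fun K _ => mul_comm _ _

theorem gIP_add (N : ℕ) (a b c : Fin N × Fin N → ℝ) :
    gridIP N (a + b) c = gridIP N a c + gridIP N b c := by
  unfold gridIP
  rw [← mul_add, ← Finset.sum_add_distrib]
  congr 1
  exact Finset.sum_congr rfl fun K _ => by simp [add_mul]

theorem gIP_smul (N : ℕ) (t : ℝ) (a c : Fin N × Fin N → ℝ) :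
    gridIP N (t • a) c = t * gridIP N a c := by
  unfold gridIP
  rw [mul_left_comm, Finset.mul_sum (a := t)]
  congr 1
  exact Finset.sum_congr rfl fun K _ => by simp [mul_assoc]

theorem gIP_sub (N : ℕ) (a b c : Fin N × Fin N → ℝ) :
    gridIP N (a - b) c = gridIP N a c - gridIP N b c := by
  have h := gIP_add N (a - b) b c
  rw [sub_add_cancel] at h
  linarith

theorem gIP_sub_right (N : ℕ) (a b c : Fin N × Fin N → ℝ) :
    gridIP N c (a - b) = gridIP N c a - gridIP N c b := by
  rw [gIP_comm, gIP_sub, gIP_comm N a, gIP_comm N b]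

theorem gIP_self_nonneg (N : ℕ) (a : Fin N × Fin N → ℝ) : 0 ≤ gridIP N a a := by
  unfold gridIP
  exact mul_nonneg (sq_nonneg _) (Finset.sum_nonneg fun K _ => mul_self_nonneg _)

theorem gGrad_sub (N : ℕ) (a b c : Fin N × Fin N → ℝ) :
    gridGradIP N (a - b) c = gridGradIP N a c - gridGradIP N b c := by
  unfold gridGradIP
  rw [← mul_sub, ← Finset.sum_sub_distrib]
  congr 1
  refine Finset.sum_congr rfl fun K _ => ?_
  rw [← Finset.sum_sub_distrib]
  refine Finset.sum_congr rfl fun L _ => ?_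
  split_ifs
  · simp only [Pi.sub_apply]; ring
  · simp

theorem gGrad_nonneg (N : ℕ) (a : Fin N × Fin N → ℝ) : 0 ≤ gridGradIP N a a := by
  unfold gridGradIP
  refine mul_nonneg (by norm_num) (Finset.sum_nonneg fun K _ => Finset.sum_nonneg fun L _ => ?_)
  split_ifs
  · exact mul_self_nonneg _
  · exact le_rfl

theorem obsAvg_sub (N m : ℕ) (a b : Fin N × Fin N → ℝ) :
    obsAvg N m (a - b) = obsAvg N m a - obsAvg N m b := by
  funext K
  simp only [obsAvg, Pi.sub_apply]
  rw [← mul_sub, ← Finset.sum_sub_distrib]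
  congr 1
  refine Finset.sum_congr rfl fun L _ => ?_
  split_ifs <;> simp

theorem obsAvg_symm (N m : ℕ) (a b : Fin N × Fin N → ℝ) :
    gridIP N (obsAvg N m a) b = gridIP N a (obsAvg N m b) := by
  unfold gridIP obsAvg
  congr 1
  simp only [Finset.mul_sum, Finset.sum_mul]
  rw [Finset.sum_comm]
  refine Finset.sum_congr rfl fun K _ => Finset.sum_congr rfl fun L _ => ?_
  by_cases h : (K.1 : ℕ) / m = (L.1 : ℕ) / m ∧ (K.2 : ℕ) / m = (L.2 : ℕ) / m
  · rw [if_pos h, if_pos ⟨h.1.symm, h.2.symm⟩]; ring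
  · rw [if_neg h, if_neg fun h' => h ⟨h'.1.symm, h'.2.symm⟩]; ring

theorem obsAvg_one (N m : ℕ) (hN : 0 < N) (c : ℝ)
    (hinterp : ∀ w : Fin N × Fin N → ℝ,
      gridNormSq N (w - obsAvg N m w) ≤ c * gridGradNormSq N w) (K : Fin N × Fin N) :
    obsAvg N m (fun _ => 1) K = 1 := by
  have h := hinterp (fun _ => 1)
  have h0 : gridGradNormSq N (fun _ => 1) = 0 := by
    simp [gridGradNormSq, gridGradIP]
  rw [h0, mul_zero] at h
  unfold gridNormSq gridIP at h
  have hp : (0 : ℝ) < ((1 : ℝ) / N) ^ 2 := by positivity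
  have h1 := nonpos_of_mul_nonpos_right h hp
  have h2 := Finset.single_le_sum (s := Finset.univ)
    (f := fun K : Fin N × Fin N => (1 - obsAvg N m (fun _ => 1) K) *
      (1 - obsAvg N m (fun _ => 1) K))
    (fun K _ => mul_self_nonneg _) (Finset.mem_univ K)
  have h3 := mul_self_eq_zero.mp (le_antisymm (h2.trans h1) (mul_self_nonneg _))
  linarith

theorem obsAvg_idem (N m : ℕ) (h1 : ∀ K, obsAvg N m (fun _ => 1) K = 1)
    (w : Fin N × Fin N → ℝ) : obsAvg N m (obsAvg N m w) = obsAvg N m w := by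
  funext K
  have key : obsAvg N m (obsAvg N m w) K = obsAvg N m (fun _ => 1) K * obsAvg N m w K := by
    conv_lhs => unfold obsAvg
    conv_rhs => rw [obsAvg]
    rw [mul_assoc, Finset.sum_mul]
    congr 1
    refine Finset.sum_congr rfl fun L _ => ?_
    split_ifs with h
    · simp only [obsAvg, h.1, h.2, one_mul]
    · simp
  rw [key, h1, one_mul]

/-- Young's inequality for the grid inner product. -/
theorem gIP_young (N : ℕ) (ε : ℝ) (hε : 0 < ε) (z a : Fin N × Fin N → ℝ) :
    gridIP N z a ≤ ε * gridIP N z z + 1 / (4 * ε) * gridIP N a a := by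
  unfold gridIP
  have : ∑ K, z K * a K ≤ ε * ∑ K, z K * z K + 1 / (4 * ε) * ∑ K, a K * a K := by
    rw [Finset.mul_sum, Finset.mul_sum, ← Finset.sum_add_distrib]
    refine Finset.sum_le_sum fun K _ => ?_
    have : ε * (z K * z K) + 1 / (4 * ε) * (a K * a K) - z K * a K
        = (2 * ε * z K - a K) ^ 2 / (4 * ε) := by field_simp; ring
    have h2 : 0 ≤ (2 * ε * z K - a K) ^ 2 / (4 * ε) := by positivity
    linarith
  have := mul_le_mul_of_nonneg_left this (sq_nonneg ((1 : ℝ) / N))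
  linarith

/-- Energy estimate for a single nudged equation. -/
theorem one_eq_step (N m : ℕ) (d A Δt μ ε c : ℝ) (hA : 0 ≤ A) (hΔt : 0 < Δt) (hμ : 0 ≤ μ)
    (hε : 0 < ε) (h1 : ∀ K, obsAvg N m (fun _ => 1) K = 1)
    (hinterp : ∀ w : Fin N × Fin N → ℝ,
      gridNormSq N (w - obsAvg N m w) ≤ c * gridGradNormSq N w)
    (e E g : Fin N × Fin N → ℝ)
    (heq : gridIP N (E - e) E + Δt * d * gridGradIP N E E =
      Δt * (gridIP N g E - A * gridIP N e E - μ * gridIP N (obsAvg N m e) E)) :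
    gridNormSq N E - gridNormSq N e + gridNormSq N (E - e) + 2 * Δt * d * gridGradNormSq N E ≤
      2 * Δt * (gridIP N g E - (1 - 1 / (4 * ε)) * (A + μ) * gridNormSq N E
        + ε * (A + μ) * gridNormSq N (E - e) + ε * μ * c * gridGradNormSq N E) := by
  have hi := hinterp E
  unfold gridNormSq gridGradNormSq at *
  have hy1 := gIP_young N ε hε (E - e) E
  set I := obsAvg N m with hI
  have hy2 := gIP_young N ε hε ((E - I E) + I (E - e)) E
  have hort : gridIP N (E - I E) (I (E - e)) = 0 := by
    rw [← obsAvg_symm, obsAvg_sub, obsAvg_idem N m h1, sub_self]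
    simp [gridIP]
  have hproj : gridIP N (I (E - e)) (I (E - e)) ≤ gridIP N (E - e) (E - e) := by
    have hn := gIP_self_nonneg N ((E - e) - I (E - e))
    have hs : gridIP N (I (E - e)) (I (E - e)) = gridIP N (E - e) (I (E - e)) := by
      conv_lhs => rw [hI, obsAvg_symm, obsAvg_idem N m h1]
    rw [gIP_sub, gIP_sub_right N (E - e) (I (E - e)), gIP_sub_right N (E - e) (I (E - e)),
      gIP_comm N (I (E - e)) (E - e)] at hn
    linarith
  have hz : gridIP N ((E - I E) + I (E - e)) ((E - I E) + I (E - e))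
      = gridIP N (E - I E) (E - I E) + gridIP N (I (E - e)) (I (E - e)) := by
    rw [gIP_add, gIP_comm N _ (_ + _), gIP_comm N _ (_ + _), gIP_add, gIP_add, hort,
      gIP_comm N (I (E - e)) (E - I E), hort]
    ring
  rw [hz] at hy2
  have hz2 : gridIP N ((E - I E) + I (E - e)) E = gridIP N E E - gridIP N (I e) E := by
    rw [gIP_add, gIP_sub, hI, obsAvg_sub, gIP_sub]; ring
  rw [hz2] at hy2
  have hpol : 2 * gridIP N (E - e) E
      = gridIP N E E - gridIP N e e + gridIP N (E - e) (E - e) := by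
    rw [gIP_sub_right, gIP_sub, gIP_sub, gIP_comm N E e]; ring
  have hx : gridIP N (E - e) E = gridIP N E E - gridIP N e E := gIP_sub _ _ _ _
  have hy2' : gridIP N E E - gridIP N (I e) E ≤
      ε * (c * gridGradIP N E E + gridIP N (E - e) (E - e)) + 1 / (4 * ε) * gridIP N E E := by
    have := mul_le_mul_of_nonneg_left (add_le_add hi hproj) hε.le
    linarith
  rw [hx] at hy1
  have k1 := mul_le_mul_of_nonneg_left hy1 hA
  have k2 := mul_le_mul_of_nonneg_left hy2' hμ
  have k3 : gridIP N g E - A * gridIP N e E - μ * gridIP N (I e) E ≤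
      (gridIP N g E - (1 - 1 / (4 * ε)) * (A + μ) * gridIP N E E
        + ε * (A + μ) * gridIP N (E - e) (E - e) + ε * μ * c * gridGradIP N E E) := by
    linarith
  have k4 := mul_le_mul_of_nonneg_left k3 hΔt.le
  linarith

theorem nl_pointwise (V a b x y E G : ℝ) (ha : 0 ≤ a) (hb : 0 ≤ b)
    (hab : a + b ≤ V) :
    -(a * (E - x) + b * (G - y)) * E + (a * (E - x) + b * (G - y)) * G ≤
      2 * V * (E * E + G * G) + V * (x * x + y * y) := by
  have h1 : 0 ≤ (V - a - b) * (2 * (E * E + G * G) + (x * x + y * y)) :=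
    mul_nonneg (by linarith) (by 
      nlinarith [mul_self_nonneg E, mul_self_nonneg G,
        mul_self_nonneg x, mul_self_nonneg y])
  have h2 : 0 ≤ a * (2 * (E * E + G * G) + (x * x + y * y) + (E - x) * (E - G)) :=
    mul_nonneg ha (by
      nlinarith [sq_nonneg (x + (E - G) / 2), sq_nonneg (x - (E - G) / 2),
        sq_nonneg (E + G), sq_nonneg (E - G), sq_nonneg y, sq_nonneg E, sq_nonneg G])
  have h3 : 0 ≤ b * (2 * (E * E + G * G) + (x * x + y * y) + (G - y) * (E - G)) :=
    mul_nonneg hb (by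
      nlinarith [sq_nonneg (y + (E - G) / 2), sq_nonneg (y - (E - G) / 2),
        sq_nonneg (E + G), sq_nonneg (E - G), sq_nonneg x, sq_nonneg E, sq_nonneg G])
  nlinarith

theorem nl_bound (N : ℕ) (V : ℝ) (a b e f E G : Fin N × Fin N → ℝ) (ha : ∀ K, 0 ≤ a K)
    (hb : ∀ K, 0 ≤ b K) (hab : ∀ K, a K + b K ≤ V) :
    gridIP N (fun K => -(a K * e K + b K * f K)) E + gridIP N (fun K => a K * e K + b K * f K) G
      ≤ 2 * V * (gridNormSq N E + gridNormSq N G)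
        + V * (gridNormSq N (E - e) + gridNormSq N (G - f)) := by
  unfold gridNormSq gridIP
  have : ∑ K, -(a K * e K + b K * f K) * E K + ∑ K, (a K * e K + b K * f K) * G K ≤
      2 * V * (∑ K, E K * E K + ∑ K, G K * G K)
      + V * (∑ K, (E - e) K * (E - e) K + ∑ K, (G - f) K * (G - f) K) := by
    rw [← Finset.sum_add_distrib, ← Finset.sum_add_distrib, ← Finset.sum_add_distrib,
      Finset.mul_sum, Finset.mul_sum, ← Finset.sum_add_distrib]
    refine Finset.sum_le_sum fun K _ => ?_
    have := nl_pointwise V (a K) (b K) (E K - e K) (G K - f K) (E K) (G K) (ha K) (hb K) (hab K)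
    simpa using this
  have := mul_le_mul_of_nonneg_left this (sq_nonneg ((1 : ℝ) / N))
  linarith

/-- Synchronization at the discrete level (Theorem 4.8). -/
theorem discrete_synchronization (N m M : ℕ) (hm : 1 ≤ m) (hM : 1 ≤ M) (hN : N = m * M)
    (H : ℝ) (hH : H = 1 / (M : ℝ))
    (du dv F k Δt μu μv : ℝ) (hdu : 0 < du) (hdv : 0 < dv) (hF : 0 < F) (hk : 0 < k)
    (hΔt : 0 < Δt) (hμu : 0 ≤ μu) (hμv : 0 ≤ μv)
    (u v ut vt : ℕ → Fin N × Fin N → ℝ)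
    (hgs : GrayScottScheme N du dv F k Δt u v)
    (hnud : NudgedScheme N m du dv F k Δt μu μv u v ut vt)
    (vmax : ℝ) (hvmax : 0 ≤ vmax)
    (hub : ∀ n K, 0 ≤ u n K ∧ u n K ≤ 1)
    (hvb : ∀ n K, 0 ≤ v n K ∧ v n K ≤ vmax)
    (hvtb : ∀ n K, 0 ≤ vt n K ∧ vt n K ≤ vmax)
    (γ₀ : ℝ) (hγ₀ : 0 < γ₀)
    (hinterp : ∀ w : Fin N × Fin N → ℝ,
      gridNormSq N (w - obsAvg N m w) ≤ γ₀ * H ^ 2 * gridGradNormSq N w)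
    (ε : ℝ) (hε : 1 / 4 < ε)
    (hcoer : ε * max μu μv * γ₀ * H ^ 2 ≤ min du dv)
    (hstep : Δt * (2 * ε * (F + k + max μu μv) + 2 * (vmax ^ 2 + 2 * vmax)) ≤ 1)
    (δ : ℝ)
    (hδdef : δ = min ((1 - 1 / (4 * ε)) * (F + μu)) ((1 - 1 / (4 * ε)) * (F + k + μv))
      - 2 * (vmax ^ 2 + 2 * vmax))
    (hδ : 0 < δ) :
    ∀ mm : ℕ,
      (gridNormSq N (ut mm - u mm) + gridNormSq N (vt mm - v mm) ≤
        (gridNormSq N (ut 0 - u 0) + gridNormSq N (vt 0 - v 0)) * ((1 + 2 * δ * Δt)⁻¹) ^ mm) ∧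
      (gridNormSq N (ut mm - u mm) + gridNormSq N (vt mm - v mm)
        + (1 - Δt * (2 * ε * (F + k + max μu μv) + 2 * (vmax ^ 2 + 2 * vmax))) *
            ∑ n ∈ Finset.Icc 1 mm,
              (gridNormSq N ((ut n - u n) - (ut (n - 1) - u (n - 1)))
                + gridNormSq N ((vt n - v n) - (vt (n - 1) - v (n - 1))))
        + 2 * Δt * (min du dv - ε * max μu μv * γ₀ * H ^ 2) *
            ∑ n ∈ Finset.Icc 1 mm,
              (gridGradNormSq N (ut n - u n) + gridGradNormSq N (vt n - v n))
        ≤ gridNormSq N (ut 0 - u 0) + gridNormSq N (vt 0 - v 0)) := by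
  have hNpos : 0 < N := by rw [hN]; exact Nat.mul_pos hm hM
  have hε0 : 0 < ε := by linarith
  have h1 := obsAvg_one N m hNpos (γ₀ * H ^ 2) hinterp
  have step : ∀ n : ℕ,
      (1 + 2 * δ * Δt) *
        (gridNormSq N (ut (n + 1) - u (n + 1)) + gridNormSq N (vt (n + 1) - v (n + 1)))
      + (1 - Δt * (2 * ε * (F + k + max μu μv) + 2 * (vmax ^ 2 + 2 * vmax))) *
          (gridNormSq N ((ut (n + 1) - u (n + 1)) - (ut n - u n))
            + gridNormSq N ((vt (n + 1) - v (n + 1)) - (vt n - v n)))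
      + 2 * Δt * (min du dv - ε * max μu μv * γ₀ * H ^ 2) *
          (gridGradNormSq N (ut (n + 1) - u (n + 1)) + gridGradNormSq N (vt (n + 1) - v (n + 1)))
      ≤ gridNormSq N (ut n - u n) + gridNormSq N (vt n - v n) := by
    intro n
    set E := ut (n + 1) - u (n + 1) with hE
    set G := vt (n + 1) - v (n + 1) with hG
    set e := ut n - u n with he
    set f := vt n - v n with hf
    set a : Fin N × Fin N → ℝ := fun K => vt n K ^ 2 with ha
    set b : Fin N × Fin N → ℝ := fun K => u n K * (vt n K + v n K) with hb
    have hnl := nl_bound N (vmax ^ 2 + 2 * vmax) a b e f E G (fun K => sq_nonneg _)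
      (fun K => mul_nonneg (hub n K).1 (add_nonneg (hvtb n K).1 (hvb n K).1))
      (fun K => by
        have p1 := hub n K
        have p2 := hvb n K
        have p3 := hvtb n K
        simp only [ha, hb]
        have q1 : vt n K ^ 2 ≤ vmax ^ 2 := pow_le_pow_left₀ p3.1 p3.2 2
        have q2 : u n K * (vt n K + v n K) ≤ 1 * (vt n K + v n K) :=
          mul_le_mul_of_nonneg_right p1.2 (by linarith)
        linarith)
    have equ : gridIP N (E - e) E + Δt * du * gridGradIP N E E =
        Δt * (gridIP N (fun K => -(a K * e K + b K * f K)) E - F * gridIP N e E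
          - μu * gridIP N (obsAvg N m e) E) := by
      have t1 := (hgs n E).1
      have t2 := (hnud n E).1
      have s1 : E - e = (ut (n + 1) - ut n) - (u (n + 1) - u n) := by rw [hE, he]; abel
      have s2 : gridGradIP N E E = gridGradIP N (ut (n + 1)) E - gridGradIP N (u (n + 1)) E := by
        conv_lhs => rw [hE, gGrad_sub, ← hE]
      have s3 : (fun K => -(ut n K) * (vt n K) ^ 2 + F * (1 - ut n K)
          + μu * (obsAvg N m (u n) K - obsAvg N m (ut n) K))
          - (fun K => -(u n K) * (v n K) ^ 2 + F * (1 - u n K))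
          = (fun K => -(a K * e K + b K * f K)) - F • e - μu • obsAvg N m e := by
        rw [he, obsAvg_sub]
        funext K
        simp only [ha, hb, hf, Pi.sub_apply, Pi.smul_apply, smul_eq_mul]
        ring
      have s4 := congrArg (fun w => gridIP N w E) s3
      simp only [gIP_sub, gIP_smul] at s4
      rw [← s4, s1, gIP_sub, s2]
      linarith
    have eqv : gridIP N (G - f) G + Δt * dv * gridGradIP N G G =
        Δt * (gridIP N (fun K => (a K * e K + b K * f K)) G - (F + k) * gridIP N f G
          - μv * gridIP N (obsAvg N m f) G) := by
      have t1 := (hgs n G).2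
      have t2 := (hnud n G).2
      have s1 : G - f = (vt (n + 1) - vt n) - (v (n + 1) - v n) := by rw [hG, hf]; abel
      have s2 : gridGradIP N G G = gridGradIP N (vt (n + 1)) G - gridGradIP N (v (n + 1)) G := by
        conv_lhs => rw [hG, gGrad_sub, ← hG]
      have s3 : (fun K => ut n K * (vt n K) ^ 2 - (F + k) * vt n K
          + μv * (obsAvg N m (v n) K - obsAvg N m (vt n) K))
          - (fun K => u n K * (v n K) ^ 2 - (F + k) * v n K)
          = (fun K => (a K * e K + b K * f K)) - (F + k) • f - μv • obsAvg N m f := by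
        rw [hf, obsAvg_sub]
        funext K
        simp only [ha, hb, he, Pi.sub_apply, Pi.smul_apply, smul_eq_mul]
        ring
      have s4 := congrArg (fun w => gridIP N w G) s3
      simp only [gIP_sub, gIP_smul] at s4
      rw [← s4, s1, gIP_sub, s2]
      linarith
    have ru := one_eq_step N m du F Δt μu ε (γ₀ * H ^ 2) hF.le hΔt hμu hε0 h1 hinterp e E _ equ
    have rv := one_eq_step N m dv (F + k) Δt μv ε (γ₀ * H ^ 2) (by linarith) hΔt hμv hε0 h1
      hinterp f G _ eqv
    have nE : 0 ≤ gridNormSq N E := gIP_self_nonneg N E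
    have nG : 0 ≤ gridNormSq N G := gIP_self_nonneg N G
    have nx : 0 ≤ gridNormSq N (E - e) := gIP_self_nonneg N _
    have ny : 0 ≤ gridNormSq N (G - f) := gIP_self_nonneg N _
    have gE : 0 ≤ gridGradNormSq N E := gGrad_nonneg N E
    have gG : 0 ≤ gridGradNormSq N G := gGrad_nonneg N G
    have mu1 := le_max_left μu μv
    have mu2 := le_max_right μu μv
    have d1 : δ + 2 * (vmax ^ 2 + 2 * vmax) ≤ (1 - 1 / (4 * ε)) * (F + μu) := by
      rw [hδdef, sub_add_cancel]; exact min_le_left _ _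
    have d2 : δ + 2 * (vmax ^ 2 + 2 * vmax) ≤ (1 - 1 / (4 * ε)) * (F + k + μv) := by
      rw [hδdef, sub_add_cancel]; exact min_le_right _ _
    have D1 := mul_le_mul_of_nonneg_right d1 nE
    have D2 := mul_le_mul_of_nonneg_right d2 nG
    have e1 : ε * (F + μu) ≤ ε * (F + k + max μu μv) :=
      mul_le_mul_of_nonneg_left (by linarith) hε0.le
    have e2 : ε * (F + k + μv) ≤ ε * (F + k + max μu μv) :=
      mul_le_mul_of_nonneg_left (by linarith) hε0.le
    have E1 := mul_le_mul_of_nonneg_right e1 nx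
    have E2 := mul_le_mul_of_nonneg_right e2 ny
    have hc : 0 ≤ γ₀ * H ^ 2 := by positivity
    have c1 : min du dv - ε * max μu μv * (γ₀ * H ^ 2) ≤ du - ε * μu * (γ₀ * H ^ 2) :=
      sub_le_sub (min_le_left _ _)
        (mul_le_mul_of_nonneg_right (mul_le_mul_of_nonneg_left mu1 hε0.le) hc)
    have c2 : min du dv - ε * max μu μv * (γ₀ * H ^ 2) ≤ dv - ε * μv * (γ₀ * H ^ 2) :=
      sub_le_sub (min_le_right _ _)
        (mul_le_mul_of_nonneg_right (mul_le_mul_of_nonneg_left mu2 hε0.le) hc)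
    have C1 := mul_le_mul_of_nonneg_right c1 gE
    have C2 := mul_le_mul_of_nonneg_right c2 gG
    have tot := mul_le_mul_of_nonneg_left
      (add_le_add (add_le_add (add_le_add hnl (add_le_add D1 D2)) (add_le_add E1 E2))
        (add_le_add C1 C2)) hΔt.le
    linarith
  have hq : 0 < 1 + 2 * δ * Δt := by positivity
  have hnn : ∀ w : Fin N × Fin N → ℝ, 0 ≤ gridNormSq N w := fun w => gIP_self_nonneg N w
  have hgn : ∀ w : Fin N × Fin N → ℝ, 0 ≤ gridGradNormSq N w := fun w => gGrad_nonneg N w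
  intro mm
  induction mm with
  | zero => simp
  | succ n ih =>
    have s := step n
    obtain ⟨ih1, ih2⟩ := ih
    constructor
    · have p1 : 0 ≤ (1 - Δt * (2 * ε * (F + k + max μu μv) + 2 * (vmax ^ 2 + 2 * vmax))) *
          (gridNormSq N ((ut (n + 1) - u (n + 1)) - (ut n - u n))
            + gridNormSq N ((vt (n + 1) - v (n + 1)) - (vt n - v n))) :=
        mul_nonneg (by linarith) (add_nonneg (hnn _) (hnn _))
      have p2 : 0 ≤ 2 * Δt * (min du dv - ε * max μu μv * γ₀ * H ^ 2) *
          (gridGradNormSq N (ut (n + 1) - u (n + 1))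
            + gridGradNormSq N (vt (n + 1) - v (n + 1))) :=
        mul_nonneg (mul_nonneg (by linarith) (by linarith)) (add_nonneg (hgn _) (hgn _))
      rw [pow_succ, ← mul_assoc, ← div_eq_mul_inv, le_div_iff₀ hq]
      linarith
    · rw [Finset.sum_Icc_succ_top (by omega), Finset.sum_Icc_succ_top (by omega)]
      simp only [Nat.add_sub_cancel]
      have p3 : 0 ≤ 2 * δ * Δt *
          (gridNormSq N (ut (n + 1) - u (n + 1)) + gridNormSq N (vt (n + 1) - v (n + 1))) :=
        mul_nonneg (by positivity) (add_nonneg (hnn _) (hnn _))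
      linarith
end

section
/- Synchronization at the continuous level (precise classical-solution form of Theorem 4.6). Let d_u, d_v, F, k > 0, μ_u, μ_v ≥ 0 and v_max ≥ 0. Let (u, v) be a classical solution of the Gray–Scott system ∂_t u = d_u Δu − u v² + F(1 − u), ∂_t v = d_v Δv + u v² − (F + k) v on (0,∞) × D, and let (ũ, ṽ) be a classical solution of the nudged system ∂_t ũ = d_u Δũ − ũ ṽ² + F(1 − ũ) + μ_u(𝓘_H u − 𝓘_H ũ), ∂_t ṽ = d_v Δṽ + ũ ṽ² − (F + k) ṽ + μ_v(𝓘_H v − 𝓘_H ṽ), where D = [0,1]², both pairs satisfying the homogeneous Neumann boundary condition (vanishing outward normal derivative on ∂D) for every t > 0. Assume all four functions are continuous on [0,∞) × D, once continuously differentiable in time and twice continuously differentiable in space on (0,∞) × D with spatial derivatives continuous up to ∂D, and satisfy 0 ≤ u ≤ 1, 0 ≤ ũ ≤ 1, 0 ≤ v ≤ v_max, 0 ≤ ṽ ≤ v_max pointwise. Let γ₀ > 0 be a constant such that ‖w − 𝓘_H w‖_{L²(D)}² ≤ γ₀ H² ‖∇w‖_{L²(D)}² for every continuously differentiable function w on D.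 Suppose there exists ε > 1/4 such that min(d_u, d_v) ≥ ε max(μ_u, μ_v) γ₀ H² and γ := min{F + μ_u(1 − 1/(4ε)), F + k + μ_v(1 − 1/(4ε))} − C_NL > 0. Then, with e := ũ − u and f := ṽ − v, for every t ≥ 0: ‖e(t)‖_{L²(D)}² + ‖f(t)‖_{L²(D)}² ≤ (‖e(0)‖_{L²(D)}² + ‖f(0)‖_{L²(D)}²) e^{−2γt}. -/
open MeasureTheory

/-- The unit square `D = [0,1]²`. -/
def UnitSquare : Set (ℝ × ℝ) := Set.Icc (0 : ℝ) 1 ×ˢ Set.Icc (0 : ℝ) 1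

/-- Cell-average interpolant `𝓘_H` on the uniform `M × M` partition of the unit square
into squares of side `H = 1/M`: on each cell, the value is the cell average. -/
noncomputable def cellAvg (M : ℕ) (w : ℝ × ℝ → ℝ) (x : ℝ × ℝ) : ℝ :=
  let i : ℕ := min ⌊x.1 * M⌋₊ (M - 1)
  let j : ℕ := min ⌊x.2 * M⌋₊ (M - 1)
  (M : ℝ) ^ 2 * ∫ y in Set.Icc ((i : ℝ) / M) (((i : ℝ) + 1) / M) ×ˢ
      Set.Icc ((j : ℝ) / M) (((j : ℝ) + 1) / M), w y

/-- Spatial Laplacian of a function on `ℝ²`. -/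
noncomputable def lapl (w : ℝ × ℝ → ℝ) (x : ℝ × ℝ) : ℝ :=
  iteratedFDeriv ℝ 2 w x ![((1 : ℝ), (0 : ℝ)), ((1 : ℝ), (0 : ℝ))] +
    iteratedFDeriv ℝ 2 w x ![((0 : ℝ), (1 : ℝ)), ((0 : ℝ), (1 : ℝ))]

/-- Homogeneous Neumann boundary condition on the unit square: the outward normal
derivative vanishes on each of the four edges. -/
def NeumannBC (w : ℝ × ℝ → ℝ) : Prop :=
  ∀ s ∈ Set.Icc (0 : ℝ) 1,
    fderivWithin ℝ w UnitSquare ((0 : ℝ), s) ((1 : ℝ), (0 : ℝ)) = 0 ∧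
    fderivWithin ℝ w UnitSquare ((1 : ℝ), s) ((1 : ℝ), (0 : ℝ)) = 0 ∧
    fderivWithin ℝ w UnitSquare (s, (0 : ℝ)) ((0 : ℝ), (1 : ℝ)) = 0 ∧
    fderivWithin ℝ w UnitSquare (s, (1 : ℝ)) ((0 : ℝ), (1 : ℝ)) = 0

/-- Regularity of a classical solution on `[0,∞) × D`: continuity on `[0,∞) × D` and,
for each `t > 0`, `C²` regularity in space on `D` (derivatives continuous up to `∂D`). -/
def ClassicalReg (w : ℝ → ℝ × ℝ → ℝ) : Prop :=
  ContinuousOn (fun p : ℝ × (ℝ × ℝ) => w p.1 p.2) (Set.Ici (0 : ℝ) ×ˢ UnitSquare) ∧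
  ∀ t : ℝ, 0 < t → ContDiffOn ℝ 2 (w t) UnitSquare

section Helpers


open Set Filter Topology

lemma us_uniqueDiff : UniqueDiffOn ℝ UnitSquare :=
  (uniqueDiffOn_Icc zero_lt_one).prod (uniqueDiffOn_Icc zero_lt_one)

lemma us_interior : interior UnitSquare = Ioo (0:ℝ) 1 ×ˢ Ioo (0:ℝ) 1 := by
  rw [UnitSquare, interior_prod_eq, interior_Icc]

lemma us_compact : IsCompact UnitSquare := isCompact_Icc.prod isCompact_Icc

lemma us_meas : MeasurableSet UnitSquare := measurableSet_Icc.prod measurableSet_Icc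

lemma us_restrict : (volume : Measure (ℝ × ℝ)).restrict UnitSquare
    = volume.restrict (interior UnitSquare) := by
  rw [us_interior, UnitSquare, Measure.volume_eq_prod, ← Measure.prod_restrict,
    ← Measure.prod_restrict, restrict_Ioo_eq_restrict_Icc]

lemma us_int_nhds {x : ℝ × ℝ} (hx : x ∈ interior UnitSquare) : UnitSquare ∈ 𝓝 x :=
  mem_interior_iff_mem_nhds.1 hx

/-- x partial derivative -/
noncomputable def pdx (w : ℝ × ℝ → ℝ) (x : ℝ × ℝ) : ℝ :=
  fderivWithin ℝ w UnitSquare x ((1 : ℝ), (0 : ℝ))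
/-- y partial derivative -/
noncomputable def pdy (w : ℝ × ℝ → ℝ) (x : ℝ × ℝ) : ℝ :=
  fderivWithin ℝ w UnitSquare x ((0 : ℝ), (1 : ℝ))

lemma pdx_contDiffOn {w : ℝ × ℝ → ℝ} (hw : ContDiffOn ℝ 2 w UnitSquare) :
    ContDiffOn ℝ 1 (pdx w) UnitSquare :=
  (hw.fderivWithin us_uniqueDiff (m := 1) (by norm_num)).clm_apply contDiffOn_const

lemma pdy_contDiffOn {w : ℝ × ℝ → ℝ} (hw : ContDiffOn ℝ 2 w UnitSquare) :
    ContDiffOn ℝ 1 (pdy w) UnitSquare :=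
  (hw.fderivWithin us_uniqueDiff (m := 1) (by norm_num)).clm_apply contDiffOn_const

lemma pdx_cont {w : ℝ × ℝ → ℝ} (hw : ContDiffOn ℝ 1 w UnitSquare) :
    ContinuousOn (pdx w) UnitSquare :=
  (hw.continuousOn_fderivWithin us_uniqueDiff (by norm_num)).clm_apply continuousOn_const

lemma pdy_cont {w : ℝ × ℝ → ℝ} (hw : ContDiffOn ℝ 1 w UnitSquare) :
    ContinuousOn (pdy w) UnitSquare :=
  (hw.continuousOn_fderivWithin us_uniqueDiff (by norm_num)).clm_apply continuousOn_const

lemma lapl_eq {w : ℝ × ℝ → ℝ} (hw : ContDiffOn ℝ 2 w UnitSquare) {x : ℝ × ℝ}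
    (hx : x ∈ interior UnitSquare) : lapl w x = pdx (pdx w) x + pdy (pdy w) x := by
  have h1 : ∀ᶠ y in 𝓝 x, fderivWithin ℝ w UnitSquare y = fderiv ℝ w y := by
    filter_upwards [isOpen_interior.mem_nhds hx] with y hy
    exact fderivWithin_of_mem_nhds (us_int_nhds hy)
  have hd : DifferentiableAt ℝ (fderiv ℝ w) x :=
    ((hw.contDiffAt (us_int_nhds hx)).fderiv_right (m := 1) (by norm_num)).differentiableAt
      (by norm_num)
  have e1 : pdx w =ᶠ[𝓝 x] fun y => fderiv ℝ w y (1,0) := h1.mono fun y hy => by simp [pdx, hy]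
  have e2 : pdy w =ᶠ[𝓝 x] fun y => fderiv ℝ w y (0,1) := h1.mono fun y hy => by simp [pdy, hy]
  have f1 : pdx (pdx w) x = fderiv ℝ (fderiv ℝ w) x (1,0) (1,0) := by
    rw [pdx, fderivWithin_of_mem_nhds (us_int_nhds hx), e1.fderiv_eq,
      fderiv_clm_apply hd (by fun_prop)]
    simp
  have f2 : pdy (pdy w) x = fderiv ℝ (fderiv ℝ w) x (0,1) (0,1) := by
    rw [pdy, fderivWithin_of_mem_nhds (us_int_nhds hx), e2.fderiv_eq,
      fderiv_clm_apply hd (by fun_prop)]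
    simp
  rw [f1, f2, lapl, iteratedFDeriv_two_apply, iteratedFDeriv_two_apply]
  simp

lemma lapl_cont {w : ℝ × ℝ → ℝ} (hw : ContDiffOn ℝ 2 w UnitSquare) :
    ContinuousOn (fun x => pdx (pdx w) x + pdy (pdy w) x) UnitSquare :=
  (pdx_cont (pdx_contDiffOn hw)).add (pdy_cont (pdy_contDiffOn hw))

lemma lapl_sub {w z : ℝ × ℝ → ℝ} (hw : ContDiffOn ℝ 2 w UnitSquare)
    (hz : ContDiffOn ℝ 2 z UnitSquare) {x : ℝ × ℝ}
    (hx : x ∈ interior UnitSquare) : lapl (fun y => w y - z y) x = lapl w x - lapl z x := by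
  have := iteratedFDeriv_sub_apply (hw.contDiffAt (us_int_nhds hx))
    (hz.contDiffAt (us_int_nhds hx))
  have e : (fun y => w y - z y) = w - z := rfl
  rw [e, lapl, this, lapl, lapl]
  simp
  ring

lemma lapl_neg {w : ℝ × ℝ → ℝ} {x : ℝ × ℝ} : lapl (fun y => - w y) x = - lapl w x := by
  have e : (fun y => - w y) = - w := rfl
  rw [e, lapl, iteratedFDeriv_neg_apply, lapl]
  simp
  ring

lemma neumann_sub {w z : ℝ × ℝ → ℝ} (hw : ContDiffOn ℝ 2 w UnitSquare)
    (hz : ContDiffOn ℝ 2 z UnitSquare) (nw : NeumannBC w) (nz : NeumannBC z) :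
    NeumannBC (fun y => w y - z y) := by
  have key : ∀ p ∈ UnitSquare, fderivWithin ℝ (fun y => w y - z y) UnitSquare p
      = fderivWithin ℝ w UnitSquare p - fderivWithin ℝ z UnitSquare p := fun p hp =>
    fderivWithin_fun_sub (us_uniqueDiff p hp) (hw.differentiableOn (by norm_num) p hp)
      (hz.differentiableOn (by norm_num) p hp)
  intro s hs
  obtain ⟨a1, a2, a3, a4⟩ := nw s hs
  obtain ⟨b1, b2, b3, b4⟩ := nz s hs
  have h0 : (0:ℝ) ∈ Icc (0:ℝ) 1 := by simp
  have h1 : (1:ℝ) ∈ Icc (0:ℝ) 1 := by simp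
  refine ⟨?_, ?_, ?_, ?_⟩
  · rw [key _ ⟨h0, hs⟩]; simp [a1, b1]
  · rw [key _ ⟨h1, hs⟩]; simp [a2, b2]
  · rw [key _ ⟨hs, h0⟩]; simp [a3, b3]
  · rw [key _ ⟨hs, h1⟩]; simp [a4, b4]

lemma neumann_neg {w : ℝ × ℝ → ℝ} (nw : NeumannBC w) : NeumannBC (fun y => - w y) := by
  intro s hs
  obtain ⟨a1, a2, a3, a4⟩ := nw s hs
  have h0 : (0:ℝ) ∈ Icc (0:ℝ) 1 := by simp
  have h1 : (1:ℝ) ∈ Icc (0:ℝ) 1 := by simp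
  have key : ∀ p ∈ UnitSquare, fderivWithin ℝ (fun y => - w y) UnitSquare p
      = - fderivWithin ℝ w UnitSquare p := fun p hp =>
    fderivWithin_fun_neg (us_uniqueDiff p hp)
  refine ⟨?_, ?_, ?_, ?_⟩
  · rw [key _ ⟨h0, hs⟩]; simp [a1]
  · rw [key _ ⟨h1, hs⟩]; simp [a2]
  · rw [key _ ⟨hs, h0⟩]; simp [a3]
  · rw [key _ ⟨hs, h1⟩]; simp [a4]

lemma us_integrable {g : ℝ × ℝ → ℝ} (hg : ContinuousOn g UnitSquare) :
    IntegrableOn g UnitSquare := hg.integrableOn_compact us_compact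

lemma us_integral_congr {f g : ℝ × ℝ → ℝ} (h : ∀ x ∈ interior UnitSquare, f x = g x) :
    ∫ x in UnitSquare, f x = ∫ x in UnitSquare, g x := by
  rw [us_restrict]
  exact setIntegral_congr_fun isOpen_interior.measurableSet h

lemma us_integrable_congr {f g : ℝ × ℝ → ℝ} (h : ∀ x ∈ interior UnitSquare, f x = g x)
    (hf : IntegrableOn f UnitSquare) : IntegrableOn g UnitSquare := by
  rw [IntegrableOn, us_restrict] at *
  exact IntegrableOn.congr_fun hf h isOpen_interior.measurableSet

lemma us_integral_mono {f g : ℝ × ℝ → ℝ} (hf : IntegrableOn f UnitSquare)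
    (hg : IntegrableOn g UnitSquare) (h : ∀ x ∈ interior UnitSquare, f x ≤ g x) :
    ∫ x in UnitSquare, f x ≤ ∫ x in UnitSquare, g x := by
  rw [IntegrableOn, us_restrict] at *
  exact setIntegral_mono_on hf hg isOpen_interior.measurableSet h

lemma green {w : ℝ × ℝ → ℝ} (hw : ContDiffOn ℝ 2 w UnitSquare) (nw : NeumannBC w) :
    ∫ x in UnitSquare, w x * (pdx (pdx w) x + pdy (pdy w) x)
      = - ∫ x in UnitSquare, (pdx w x ^ 2 + pdy w x ^ 2) := by
  have hD : UnitSquare = Icc ((0:ℝ),(0:ℝ)) (1,1) := by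
    rw [UnitSquare, Icc_prod_Icc]
  have c := hw.continuousOn
  have ca := (pdx_contDiffOn hw)
  have cb := (pdy_contDiffOn hw)
  have cL := lapl_cont hw
  have hdx : ∀ {g : ℝ × ℝ → ℝ}, ContDiffOn ℝ 1 g UnitSquare → ∀ x ∈ interior UnitSquare,
      HasFDerivAt g (fderivWithin ℝ g UnitSquare x) x := by
    intro g hg x hx
    exact ((hg.differentiableOn (by norm_num) x (interior_subset hx)).hasFDerivWithinAt).hasFDerivAt
      (us_int_nhds hx)
  have hw1 : ContDiffOn ℝ 1 w UnitSquare := hw.of_le (by norm_num)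
  have hs : ∀ x : ℝ × ℝ, x ∈ Ioo ((0:ℝ),(0:ℝ)).1 ((1:ℝ),(1:ℝ)).1 ×ˢ
      Ioo ((0:ℝ),(0:ℝ)).2 ((1:ℝ),(1:ℝ)).2 → x ∈ interior UnitSquare := by
    intro x hx; rw [us_interior]; exact hx
  have hcongr : ∀ x : ℝ × ℝ, 
      (w x • fderivWithin ℝ (pdx w) UnitSquare x + pdx w x • fderivWithin ℝ w UnitSquare x) (1,0)
      + (w x • fderivWithin ℝ (pdy w) UnitSquare x + pdy w x • fderivWithin ℝ w UnitSquare x) (0,1)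
      = w x * (pdx (pdx w) x + pdy (pdy w) x) + (pdx w x ^ 2 + pdy w x ^ 2) := by
    intro x
    simp [pdx, pdy]; ring
  have hcint : ContinuousOn (fun x => w x * (pdx (pdx w) x + pdy (pdy w) x)) UnitSquare :=
    c.mul cL
  have hcint2 : ContinuousOn (fun x => (pdx w x ^ 2 + pdy w x ^ 2)) UnitSquare :=
    (ca.continuousOn.pow 2).add (cb.continuousOn.pow 2)
  have := integral_divergence_prod_Icc_of_hasFDerivAt_of_le (E := ℝ)
    (fun x => w x * pdx w x) (fun x => w x * pdy w x)
    (fun x => w x • fderivWithin ℝ (pdx w) UnitSquare x + pdx w x • fderivWithin ℝ w UnitSquare x)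
    (fun x => w x • fderivWithin ℝ (pdy w) UnitSquare x + pdy w x • fderivWithin ℝ w UnitSquare x)
    (0,0) (1,1) (by simp)
    (by rw [← hD]; exact c.mul ca.continuousOn) (by rw [← hD]; exact c.mul cb.continuousOn)
    (fun x hx => (hdx hw1 x (hs x hx)).mul (hdx ca x (hs x hx)))
    (fun x hx => (hdx hw1 x (hs x hx)).mul (hdx cb x (hs x hx)))
    (by simp only [hcongr]; rw [← hD]; exact us_integrable (hcint.add hcint2))
  simp only [hcongr] at this
  rw [← hD, integral_add (us_integrable hcint) (us_integrable hcint2)] at this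
  have z : ∀ g : ℝ → ℝ, (∀ s ∈ Icc (0:ℝ) 1, g s = 0) → ∫ s in (0:ℝ)..1, g s = 0 := by
    intro g hg
    rw [intervalIntegral.integral_congr (g := fun _ => 0)]
    · simp
    · intro s hs; rw [uIcc_of_le zero_le_one] at hs; exact hg s hs
  rw [z _ (fun s hs => by simp [pdy, (nw s hs).2.2.2]), z _ (fun s hs => by simp [pdy, (nw s hs).2.2.1]),
    z _ (fun s hs => by simp [pdx, (nw s hs).2.1]), z _ (fun s hs => by simp [pdx, (nw s hs).1])] at this
  linarith


lemma us_convex : Convex ℝ UnitSquare := (convex_Icc 0 1).prod (convex_Icc 0 1)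

lemma second_nonpos {f f' : ℝ → ℝ} {c : ℝ} (hf : ∀ᶠ r in 𝓝 0, HasDerivAt f (f' r) r)
    (hf' : HasDerivAt f' c 0) (hmax : IsLocalMax f 0) : c ≤ 0 := by
  by_contra! hc
  have e : deriv f =ᶠ[𝓝 0] f' := hf.mono fun r hr => hr.deriv
  have h2 : deriv (deriv f) 0 = c := by rw [e.deriv_eq, hf'.deriv]
  have hmin : IsLocalMin f 0 :=
    isLocalMin_of_deriv_deriv_pos (by rw [h2]; exact hc) hmax.deriv_eq_zero
      hf.self_of_nhds.continuousAt
  have hconst : f =ᶠ[𝓝 0] fun _ => f 0 := by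
    filter_upwards [hmax, hmin] with r h1 h2
    exact le_antisymm h1 h2
  have : deriv f =ᶠ[𝓝 0] fun _ => 0 := by
    have := hconst.deriv
    simpa using this
  rw [this.deriv_eq] at h2
  simp at h2
  linarith

/-- barrier function -/
noncomputable def psi (x : ℝ × ℝ) : ℝ := (x.1 - 1/2)^2 + (x.2 - 1/2)^2

/-- derivative of the barrier -/
noncomputable def psi' (x : ℝ × ℝ) : ℝ × ℝ →L[ℝ] ℝ :=
  (2 * (x.1 - 1/2)) • ContinuousLinearMap.fst ℝ ℝ ℝ + (2 * (x.2 - 1/2)) • ContinuousLinearMap.snd ℝ ℝ ℝ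

lemma psi_deriv (x : ℝ × ℝ) : HasFDerivAt psi (psi' x) x := by
  have h1 : HasFDerivAt (fun x : ℝ × ℝ => x.1 - 1/2) (ContinuousLinearMap.fst ℝ ℝ ℝ) x :=
    (hasFDerivAt_fst).sub_const _
  have h2 : HasFDerivAt (fun x : ℝ × ℝ => x.2 - 1/2) (ContinuousLinearMap.snd ℝ ℝ ℝ) x :=
    (hasFDerivAt_snd).sub_const _
  have := (h1.pow 2).add (h2.pow 2)
  refine this.congr_fderiv ?_
  ext <;> simp [psi']

lemma psi_nonneg (x : ℝ × ℝ) : 0 ≤ psi x := by unfold psi; positivity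

lemma psi_cont : Continuous psi := by unfold psi; fun_prop

lemma psi_le {x : ℝ × ℝ} (hx : x ∈ UnitSquare) : psi x ≤ 1 := by
  obtain ⟨⟨a, b⟩, c, d⟩ := hx
  unfold psi; nlinarith

lemma max_interior {h : ℝ × ℝ → ℝ} (hh : ContDiffOn ℝ 2 h UnitSquare) (hN : NeumannBC h)
    {δ : ℝ} (hδ : 0 < δ) {x : ℝ × ℝ} (hx : x ∈ UnitSquare)
    (hmax : ∀ y ∈ UnitSquare, h y - δ * psi y ≤ h x - δ * psi x) :
    x ∈ interior UnitSquare ∧ lapl h x ≤ 4 * δ := by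
  have hM : IsLocalMaxOn (fun y => h y - δ * psi y) UnitSquare x := by
    filter_upwards [self_mem_nhdsWithin] with y hy using hmax y hy
  have hd : HasFDerivWithinAt (fun y => h y - δ * psi y)
      (fderivWithin ℝ h UnitSquare x - δ • psi' x) UnitSquare x :=
    ((hh.differentiableOn (by norm_num) x hx).hasFDerivWithinAt).sub
      ((psi_deriv x).hasFDerivWithinAt.const_smul δ)
  have key : ∀ y ∈ UnitSquare, fderivWithin ℝ h UnitSquare x (y - x) ≤ δ * psi' x (y - x) := by
    intro y hy
    have := hM.hasFDerivWithinAt_nonpos hd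
      (sub_mem_posTangentConeAt_of_segment_subset (us_convex.segment_subset hx hy))
    simpa using this
  have hint : x ∈ interior UnitSquare := by
    obtain ⟨a, b⟩ := x
    obtain ⟨ha, hb⟩ := hx
    simp only at ha hb
    have h0 : (0:ℝ) ∈ Icc (0:ℝ) 1 := by simp
    have h1 : (1:ℝ) ∈ Icc (0:ℝ) 1 := by simp
    rw [us_interior]
    have na0 : a ≠ 0 := by
      rintro rfl
      have := key (1, b) ⟨h1, hb⟩
      simp [(hN b hb).1, psi'] at this
      linarith
    have na1 : a ≠ 1 := by
      rintro rfl
      have := key (0, b) ⟨h0, hb⟩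
      have e : ((0:ℝ), b) - ((1:ℝ), b) = - ((1:ℝ), (0:ℝ)) := by simp
      rw [e, map_neg, (hN b hb).2.1] at this
      simp [psi'] at this
      linarith
    have nb0 : b ≠ 0 := by
      rintro rfl
      have := key (a, 1) ⟨ha, h1⟩
      simp [(hN a ha).2.2.1, psi'] at this
      linarith
    have nb1 : b ≠ 1 := by
      rintro rfl
      have := key (a, 0) ⟨ha, h0⟩
      have e : (a, (0:ℝ)) - (a, (1:ℝ)) = - ((0:ℝ), (1:ℝ)) := by simp
      rw [e, map_neg, (hN a ha).2.2.2] at this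
      simp [psi'] at this
      linarith
    exact ⟨⟨lt_of_le_of_ne ha.1 na0.symm, lt_of_le_of_ne ha.2 na1⟩,
      ⟨lt_of_le_of_ne hb.1 nb0.symm, lt_of_le_of_ne hb.2 nb1⟩⟩
  refine ⟨hint, ?_⟩
  rw [lapl_eq hh hint]
  have slice : ∀ e : ℝ × ℝ, ∀ c : ℝ, fderivWithin ℝ (fun y => fderivWithin ℝ h UnitSquare y e) UnitSquare x e = c →
      c - δ * (2 * (e.1 ^ 2 + e.2 ^ 2)) ≤ 0 := by
    intro e c hc
    have hline : ∀ r : ℝ, HasDerivAt (fun r : ℝ => x + r • e) e r := by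
      intro r
      simpa using ((hasDerivAt_id r).smul_const e).const_add x
    have hcont : Tendsto (fun r : ℝ => x + r • e) (𝓝 0) (𝓝 x) := by
      have := (hline 0).continuousAt.tendsto
      simpa using this
    have hev : ∀ᶠ r in 𝓝 (0:ℝ), x + r • e ∈ interior UnitSquare :=
      hcont.eventually (isOpen_interior.mem_nhds hint)
    refine second_nonpos (f := fun r => h (x + r • e) - δ * psi (x + r • e))
      (f' := fun r => fderivWithin ℝ h UnitSquare (x + r • e) e - δ * psi' (x + r • e) e) ?_ ?_ ?_
    · filter_upwards [hev] with r hr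
      have a1 : HasFDerivAt h (fderivWithin ℝ h UnitSquare (x + r • e)) (x + r • e) :=
        ((hh.differentiableOn (by norm_num) _
          (interior_subset hr)).hasFDerivWithinAt).hasFDerivAt (us_int_nhds hr)
      exact (a1.comp_hasDerivAt r (hline r)).sub
        (((psi_deriv _).comp_hasDerivAt r (hline r)).const_mul δ)
    · have cd : ContDiffOn ℝ 1 (fun y => fderivWithin ℝ h UnitSquare y e) UnitSquare :=
        (hh.fderivWithin us_uniqueDiff (m := 1) (by norm_num)).clm_apply contDiffOn_const
      have a1 : HasFDerivAt (fun y => fderivWithin ℝ h UnitSquare y e)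
          (fderivWithin ℝ (fun y => fderivWithin ℝ h UnitSquare y e) UnitSquare x) x :=
        ((cd.differentiableOn (by norm_num) x hx).hasFDerivWithinAt).hasFDerivAt
          (us_int_nhds hint)
      have a1' : HasFDerivAt (fun y => fderivWithin ℝ h UnitSquare y e)
          (fderivWithin ℝ (fun y => fderivWithin ℝ h UnitSquare y e) UnitSquare x)
          (x + (0:ℝ) • e) := by simpa using a1
      have a2 := a1'.comp_hasDerivAt (0:ℝ) (hline 0)
      rw [hc] at a2
      refine a2.sub (HasDerivAt.const_mul δ ?_)
      have b1 : HasDerivAt (fun r : ℝ => 2 * (x.1 + r * e.1 - 1/2) * e.1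
          + 2 * (x.2 + r * e.2 - 1/2) * e.2) (2 * (1 * e.1) * e.1 + 2 * (1 * e.2) * e.2) 0 := by
        refine HasDerivAt.add ?_ ?_
        · exact (((((hasDerivAt_id (0:ℝ)).mul_const e.1).const_add x.1).sub_const (1/2)).const_mul
            2).mul_const e.1
        · exact (((((hasDerivAt_id (0:ℝ)).mul_const e.2).const_add x.2).sub_const (1/2)).const_mul
            2).mul_const e.2
      have e1 : (fun r : ℝ => psi' (x + r • e) e) = (fun r : ℝ => 2 * (x.1 + r * e.1 - 1/2) * e.1
          + 2 * (x.2 + r * e.2 - 1/2) * e.2) := by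
        funext r; simp [psi']
      rw [e1]
      exact b1.congr_deriv (by ring)
    · filter_upwards [hev] with r hr
      have := hmax _ (interior_subset hr)
      simpa using this
  have s1 := slice (1,0) _ rfl
  have s2 := slice (0,1) _ rfl
  unfold pdx pdy
  norm_num at s1 s2
  linarith

lemma maxp {d G t0 : ℝ} (hd : 0 < d) (ht0 : 0 < t0) {w : ℝ → ℝ × ℝ → ℝ}
    (hreg : ClassicalReg w) (hN : ∀ t, 0 < t → NeumannBC (w t)) {g : ℝ → ℝ × ℝ → ℝ}
    (hpde : ∀ t : ℝ, 0 < t → ∀ x ∈ interior UnitSquare,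
      HasDerivAt (fun s => w s x) (d * lapl (w t) x + g t x) t)
    (hg : ∀ t : ℝ, 0 < t → ∀ x ∈ interior UnitSquare, g t x ≤ G) :
    ∃ K, ∀ t, t0 ≤ t → ∀ x ∈ UnitSquare, w t x ≤ w t0 x + K * (t - t0) := by
  obtain ⟨C, hC⟩ := us_compact.exists_bound_of_continuousOn (lapl_cont (hreg.2 t0 ht0))
  refine ⟨d * C + G + 1, fun T hT x hx => ?_⟩
  set K := d * C + G + 1 with hK
  have main : ∀ δ : ℝ, 0 < δ → 4 * d * δ < 1 → ∀ t ∈ Icc t0 T, ∀ x ∈ UnitSquare,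
      w t x - w t0 x - K * (t - t0) - δ * psi x ≤ 0 := by
    intro δ hδ hδ' t ht x hx
    have hcomp : IsCompact (Icc t0 T ×ˢ UnitSquare) := isCompact_Icc.prod us_compact
    have hc : ContinuousOn (fun p : ℝ × (ℝ × ℝ) =>
        w p.1 p.2 - w t0 p.2 - K * (p.1 - t0) - δ * psi p.2) (Icc t0 T ×ˢ UnitSquare) := by
      have c1 : ContinuousOn (fun p : ℝ × (ℝ × ℝ) => w p.1 p.2) (Icc t0 T ×ˢ UnitSquare) :=
        hreg.1.mono (prod_mono (fun s hs => le_trans ht0.le hs.1) le_rfl)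
      have c2 : ContinuousOn (fun p : ℝ × (ℝ × ℝ) => w t0 p.2) (Icc t0 T ×ˢ UnitSquare) :=
        ((hreg.2 t0 ht0).continuousOn).comp continuousOn_snd (fun p hp => hp.2)
      have c3 : Continuous (fun p : ℝ × (ℝ × ℝ) => δ * psi p.2) :=
        continuous_const.mul (psi_cont.comp continuous_snd)
      exact ((c1.sub c2).sub (by fun_prop)).sub c3.continuousOn
    obtain ⟨⟨t1, x1⟩, ⟨ht1, hx1⟩, hm⟩ := hcomp.exists_isMaxOn ⟨(t, x), ht, hx⟩ hc
    simp only at ht1 hx1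
    have hm' : ∀ s ∈ Icc t0 T, ∀ y ∈ UnitSquare,
        w s y - w t0 y - K * (s - t0) - δ * psi y ≤
        w t1 x1 - w t0 x1 - K * (t1 - t0) - δ * psi x1 := fun s hs y hy =>
      hm (show ((s, y) : ℝ × (ℝ × ℝ)) ∈ _ from ⟨hs, hy⟩)
    refine (hm' t ht x hx).trans ?_
    rcases eq_or_lt_of_le ht1.1 with h | h
    · subst h
      have := mul_nonneg hδ.le (psi_nonneg x1)
      simp; exact this
    exfalso
    have ht1' : 0 < t1 := ht0.trans h
    have hh := (hreg.2 t1 ht1').sub (hreg.2 t0 ht0)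
    obtain ⟨hi, hl⟩ := max_interior (h := fun y => w t1 y - w t0 y) hh
      (neumann_sub (hreg.2 t1 ht1') (hreg.2 t0 ht0) (hN t1 ht1') (hN t0 ht0)) hδ hx1
      (fun y hy => by have := hm' t1 ht1 y hy; linarith)
    rw [lapl_sub (hreg.2 t1 ht1') (hreg.2 t0 ht0) hi] at hl
    have hl0 : lapl (w t0) x1 ≤ C := by
      rw [lapl_eq (hreg.2 t0 ht0) hi]
      exact (le_abs_self _).trans (hC x1 hx1)
    have hD := hpde t1 ht1' x1 hi
    have hgx := hg t1 ht1' x1 hi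
    have hD2 : HasDerivAt (fun s => w s x1 - K * (s - t0))
        ((d * lapl (w t1) x1 + g t1 x1) - K * 1) t1 :=
      hD.sub (((hasDerivAt_id t1).sub_const t0).const_mul K)
    have hML : IsLocalMaxOn (fun s => w s x1 - K * (s - t0)) (Icc t0 t1) t1 := by
      filter_upwards [self_mem_nhdsWithin] with s hs
      have := hm' s ⟨hs.1, hs.2.trans ht1.2⟩ x1 hx1
      linarith
    have hh2 := hML.hasFDerivWithinAt_nonpos hD2.hasFDerivAt.hasFDerivWithinAt
      (sub_mem_posTangentConeAt_of_segment_subset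
        ((convex_Icc t0 t1).segment_subset (right_mem_Icc.2 h.le) (left_mem_Icc.2 h.le)))
    simp at hh2
    have h3 : K ≤ d * lapl (w t1) x1 + g t1 x1 := by
      by_contra! hcon
      have := mul_pos (sub_pos.2 h) (sub_pos.2 hcon)
      linarith
    have h4 : d * lapl (w t1) x1 ≤ d * (4 * δ + C) :=
      mul_le_mul_of_nonneg_left (by linarith) hd.le
    nlinarith
  by_contra! hcon
  set m := w T x - (w t0 x + K * (T - t0)) with hm
  have hmpos : 0 < m := by linarith
  have hδ : 0 < min (1 / (8 * d)) (m / 2) := by positivity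
  have := main (min (1 / (8 * d)) (m / 2)) hδ (by
    have : min (1 / (8 * d)) (m / 2) ≤ 1 / (8 * d) := min_le_left _ _
    calc 4 * d * min (1 / (8 * d)) (m / 2) ≤ 4 * d * (1 / (8 * d)) := by gcongr
      _ < 1 := by field_simp; norm_num) T (right_mem_Icc.2 hT) x hx
  have h2 : min (1 / (8 * d)) (m / 2) * psi x ≤ (m / 2) * 1 :=
    mul_le_mul (min_le_right _ _) (psi_le hx) (psi_nonneg x) (by positivity)
  linarith

lemma lip {d G t0 : ℝ} (hd : 0 < d) (ht0 : 0 < t0) {w : ℝ → ℝ × ℝ → ℝ}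
    (hreg : ClassicalReg w) (hN : ∀ t, 0 < t → NeumannBC (w t)) {g : ℝ → ℝ × ℝ → ℝ}
    (hpde : ∀ t : ℝ, 0 < t → ∀ x ∈ interior UnitSquare,
      HasDerivAt (fun s => w s x) (d * lapl (w t) x + g t x) t)
    (hg : ∀ t : ℝ, 0 < t → ∀ x ∈ interior UnitSquare, |g t x| ≤ G) :
    ∃ K, ∀ t, t0 ≤ t → ∀ x ∈ UnitSquare, |w t x - w t0 x| ≤ K * (t - t0) := by
  obtain ⟨K1, h1⟩ := maxp hd ht0 hreg hN hpde (fun t ht x hx => (abs_le.1 (hg t ht x hx)).2)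
  obtain ⟨K2, h2⟩ := maxp (w := fun t x => - w t x) (g := fun t x => - g t x) (G := G) hd ht0
    ⟨hreg.1.neg, fun t ht => (hreg.2 t ht).neg⟩ (fun t ht => neumann_neg (hN t ht))
    (fun t ht x hx => by
      have := (hpde t ht x hx).neg
      rw [lapl_neg]
      exact this.congr_deriv (by ring))
    (fun t ht x hx => by have := (abs_le.1 (hg t ht x hx)).1; linarith)
  refine ⟨max K1 K2, fun t ht x hx => ?_⟩
  have a1 := h1 t ht x hx
  have a2 := h2 t ht x hx
  have b1 : K1 * (t - t0) ≤ max K1 K2 * (t - t0) :=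
    mul_le_mul_of_nonneg_right (le_max_left _ _) (by linarith)
  have b2 : K2 * (t - t0) ≤ max K1 K2 * (t - t0) :=
    mul_le_mul_of_nonneg_right (le_max_right _ _) (by linarith)
  rw [abs_le]
  constructor <;> linarith


/-- index of the cell -/
noncomputable def idx (M : ℕ) (x : ℝ) : ℕ := min ⌊x * M⌋₊ (M - 1)

/-- left end point of a cell -/
noncomputable def nd (M : ℕ) (i : ℕ) : ℝ := (i : ℝ) / M

lemma nd_le {M : ℕ} (i : ℕ) : nd M i ≤ nd M (i + 1) := by
  unfold nd; push_cast; gcongr; linarith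

lemma nd_zero {M : ℕ} : nd M 0 = 0 := by simp [nd]

lemma nd_last {M : ℕ} (hM : 1 ≤ M) : nd M M = 1 := by
  have : (M : ℝ) ≠ 0 := by positivity
  simp [nd, this]

lemma nd_len {M : ℕ} (i : ℕ) : nd M (i + 1) - nd M i = 1 / M := by
  unfold nd; push_cast; ring

lemma idx_eq {M : ℕ} (hM : 1 ≤ M) {i : ℕ} (hi : i < M) {x : ℝ}
    (hx : x ∈ Ioo (nd M i) (nd M (i + 1))) : idx M x = i := by
  have hM' : (0:ℝ) < M := by positivity
  have h1 : (i:ℝ) < x * M := by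
    have := hx.1; unfold nd at this; rwa [div_lt_iff₀ hM'] at this
  have h2 : x * M < i + 1 := by
    have := hx.2; unfold nd at this; rw [lt_div_iff₀ hM'] at this; push_cast at this; exact this
  have h3 : ⌊x * M⌋₊ = i := by
    rw [Nat.floor_eq_iff ((Nat.cast_nonneg i).trans h1.le)]
    exact ⟨h1.le, h2⟩
  rw [idx, h3]; omega

lemma idx_lt {M : ℕ} (hM : 1 ≤ M) (x : ℝ) : idx M x < M := by
  unfold idx; omega

lemma idx_meas (M : ℕ) : Measurable (idx M) := by
  unfold idx
  exact (Nat.measurable_floor.comp (measurable_id.mul_const _)).min measurable_const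

lemma sum_cells {M : ℕ} (hM : 1 ≤ M) {f : ℝ → ℝ} (hf : Continuous f) :
    ∑ i ∈ Finset.range M, ∫ x in nd M i..nd M (i+1), f x = ∫ x in (0:ℝ)..1, f x := by
  rw [intervalIntegral.sum_integral_adjacent_intervals
    (fun k _ => hf.intervalIntegrable _ _), nd_zero, nd_last hM]

lemma sum_idx {M : ℕ} (hM : 1 ≤ M) {G : ℝ → ℕ → ℝ} (hG : ∀ i, Continuous (fun x => G x i)) :
    ∫ x in (0:ℝ)..1, G x (idx M x)
      = ∑ i ∈ Finset.range M, ∫ x in nd M i..nd M (i+1), G x i := by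
  have e : ∀ i < M, EqOn (fun x => G x i) (fun x => G x (idx M x)) (Ioo (nd M i) (nd M (i+1))) :=
    fun i hi x hx => by simp only [idx_eq hM hi hx]
  have key := intervalIntegral.sum_integral_adjacent_intervals (f := fun x => G x (idx M x))
    (μ := volume) (a := nd M) (n := M) (fun k hk =>
      ((hG k).intervalIntegrable _ _).congr_uIoo (by rw [uIoo_of_le (nd_le k)]; exact e k hk))
  rw [nd_zero, nd_last hM] at key
  rw [← key]
  refine Finset.sum_congr rfl fun i hi => ?_
  exact (intervalIntegral.integral_congr_Ioo_of_le (nd_le i) (e i (Finset.mem_range.1 hi))).symm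

lemma cell_prod {M : ℕ} (w : ℝ × ℝ → ℝ) (x : ℝ × ℝ) : cellAvg M w x = (M:ℝ)^2 *
    ∫ y in Icc (nd M (idx M x.1)) (nd M (idx M x.1 + 1)) ×ˢ
      Icc (nd M (idx M x.2)) (nd M (idx M x.2 + 1)), w y := by
  simp only [cellAvg, nd, idx]; push_cast; rfl

lemma cellAvg_meas {M : ℕ} (w : ℝ × ℝ → ℝ) : Measurable (cellAvg M w) := by
  have h : cellAvg M w = (fun p : ℕ × ℕ => (M:ℝ)^2 *
    ∫ y in Icc (nd M p.1) (nd M (p.1 + 1)) ×ˢ Icc (nd M p.2) (nd M (p.2 + 1)), w y) ∘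
      (fun x : ℝ × ℝ => (idx M x.1, idx M x.2)) := by
    funext x; rw [cell_prod]; rfl
  rw [h]
  exact (measurable_of_countable _).comp
    (((idx_meas M).comp measurable_fst).prodMk ((idx_meas M).comp measurable_snd))

lemma cell_subset {M : ℕ} (hM : 1 ≤ M) {i j : ℕ} (hi : i < M) (hj : j < M) :
    Icc (nd M i) (nd M (i + 1)) ×ˢ Icc (nd M j) (nd M (j + 1)) ⊆ UnitSquare := by
  have hM' : (0:ℝ) < M := by positivity
  have h : ∀ k < M, Icc (nd M k) (nd M (k + 1)) ⊆ Icc (0:ℝ) 1 := by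
    intro k hk
    refine Icc_subset_Icc (by unfold nd; positivity) ?_
    unfold nd
    rw [div_le_one hM']
    exact_mod_cast hk
  exact prod_mono (h i hi) (h j hj)

lemma cellAvg_congr {M : ℕ} (hM : 1 ≤ M) {w z : ℝ × ℝ → ℝ} (h : ∀ x ∈ UnitSquare, w x = z x)
    (x : ℝ × ℝ) : cellAvg M w x = cellAvg M z x := by
  rw [cell_prod, cell_prod]
  congr 1
  exact setIntegral_congr_fun (measurableSet_Icc.prod measurableSet_Icc)
    (fun y hy => h y (cell_subset hM (idx_lt hM _) (idx_lt hM _) hy))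

lemma cellAvg_sub {M : ℕ} (hM : 1 ≤ M) {w z : ℝ × ℝ → ℝ} (hw : ContinuousOn w UnitSquare)
    (hz : ContinuousOn z UnitSquare)
    (x : ℝ × ℝ) : cellAvg M (fun y => w y - z y) x = cellAvg M w x - cellAvg M z x := by
  have hs := cell_subset hM (idx_lt hM x.1) (idx_lt hM x.2)
  rw [cell_prod, cell_prod, cell_prod, integral_sub ((us_integrable hw).mono_set hs)
    ((us_integrable hz).mono_set hs)]
  ring

lemma cell_vol {M : ℕ} (i j : ℕ) : volume.real (Icc (nd M i) (nd M (i + 1)) ×ˢ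
    Icc (nd M j) (nd M (j + 1))) = 1 / M * (1 / M) := by
  rw [Measure.volume_eq_prod, measureReal_prod_prod, Real.volume_real_Icc_of_le (nd_le i),
    Real.volume_real_Icc_of_le (nd_le j), nd_len, nd_len]

lemma cellAvg_bound {M : ℕ} (hM : 1 ≤ M) {w : ℝ × ℝ → ℝ} {C : ℝ}
    (h : ∀ x ∈ UnitSquare, |w x| ≤ C) (x : ℝ × ℝ) : |cellAvg M w x| ≤ C := by
  have hM' : (0:ℝ) < M := by positivity
  have hs := cell_subset hM (idx_lt hM x.1) (idx_lt hM x.2)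
  have := norm_setIntegral_le_of_norm_le_const (μ := volume) (f := w) (C := C)
    (s := Icc (nd M (idx M x.1)) (nd M (idx M x.1 + 1)) ×ˢ
      Icc (nd M (idx M x.2)) (nd M (idx M x.2 + 1)))
    ((isCompact_Icc.prod isCompact_Icc).measure_lt_top) (fun y hy => h y (hs hy))
  rw [cell_vol, Real.norm_eq_abs] at this
  rw [cell_prod, abs_mul, abs_of_pos (by positivity : (0:ℝ) < (M:ℝ)^2)]
  calc (M:ℝ)^2 * _ ≤ (M:ℝ)^2 * (C * (1 / M * (1 / M))) := by gcongr
    _ = C := by field_simp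

/-- product formula for continuous functions -/
lemma prod_int {W : ℝ × ℝ → ℝ} (hW : Continuous W) {a b c d : ℝ} (hab : a ≤ b) (hcd : c ≤ d) :
    ∫ y in Icc a b ×ˢ Icc c d, W y = ∫ x in a..b, ∫ y in c..d, W (x, y) := by
  rw [Measure.volume_eq_prod, setIntegral_prod _
    (hW.continuousOn.integrableOn_compact (isCompact_Icc.prod isCompact_Icc)),
    intervalIntegral.integral_of_le hab, integral_Icc_eq_integral_Ioc]
  simp_rw [intervalIntegral.integral_of_le hcd, integral_Icc_eq_integral_Ioc]

lemma us_fst (f : ℝ → ℝ) : ∫ x in UnitSquare, f x.1 = ∫ x in (0:ℝ)..1, f x := by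
  have := setIntegral_prod_mul (μ := (volume : Measure ℝ)) (ν := (volume : Measure ℝ))
    f (fun _ => (1:ℝ)) (Icc (0:ℝ) 1) (Icc (0:ℝ) 1)
  rw [UnitSquare, Measure.volume_eq_prod]
  simp only [mul_one] at this
  rw [this, intervalIntegral.integral_of_le zero_le_one, integral_Icc_eq_integral_Ioc]
  simp

/-- expansion of the variance in one cell -/
lemma cell_expand {M : ℕ} (hM : 1 ≤ M) {f : ℝ → ℝ} (hf : Continuous f) (i : ℕ) :
    ∫ x in nd M i..nd M (i+1), (f x - M * ∫ s in nd M i..nd M (i+1), f s) ^ 2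
      = (∫ x in nd M i..nd M (i+1), f x ^ 2) - M * (∫ s in nd M i..nd M (i+1), f s) ^ 2 := by
  have hM' : (M:ℝ) ≠ 0 := by positivity
  set Q := ∫ s in nd M i..nd M (i+1), f s with hQ
  have : ∀ x, (f x - M * Q)^2 = f x ^ 2 - (2 * M * Q) * f x + (M * Q)^2 := fun x => by ring
  simp_rw [this]
  rw [intervalIntegral.integral_add (Continuous.intervalIntegrable (by fun_prop) _ _)
    (Continuous.intervalIntegrable (by fun_prop) _ _), intervalIntegral.integral_sub
    (Continuous.intervalIntegrable (by fun_prop) _ _)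
    (Continuous.intervalIntegrable (by fun_prop) _ _), intervalIntegral.integral_const_mul,
    intervalIntegral.integral_const, nd_len, ← hQ]
  simp only [smul_eq_mul]
  field_simp
  ring

lemma cell_cs {M : ℕ} (hM : 1 ≤ M) {f : ℝ → ℝ} (hf : Continuous f) (i : ℕ) :
    M * (∫ s in nd M i..nd M (i+1), f s) ^ 2 ≤ ∫ x in nd M i..nd M (i+1), f x ^ 2 := by
  have h1 := cell_expand hM hf i
  have h2 : 0 ≤ ∫ x in nd M i..nd M (i+1), (f x - M * ∫ s in nd M i..nd M (i+1), f s) ^ 2 :=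
    intervalIntegral.integral_nonneg (nd_le i) (fun x _ => sq_nonneg _)
  linarith

lemma one_dim {M : ℕ} (hM : 1 ≤ M) {c : ℝ} (hc : 0 ≤ c)
    (hinterp : ∀ w : ℝ × ℝ → ℝ, ContDiff ℝ 1 w →
      (∫ x in UnitSquare, (w x - cellAvg M w x) ^ 2) ≤
        c * ∫ x in UnitSquare, ‖fderiv ℝ w x‖ ^ 2)
    {f g : ℝ → ℝ} (hg : Continuous g)
    (hfg : ∀ x ∈ Icc (0:ℝ) 1, f x = f 0 + ∫ s in (0:ℝ)..x, g s) :
    (∫ x in (0:ℝ)..1, f x ^ 2) - M * ∑ i ∈ Finset.range M, (∫ s in nd M i..nd M (i+1), f s) ^ 2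
      ≤ c * ∫ x in (0:ℝ)..1, g x ^ 2 := by
  have hM' : (0:ℝ) < M := by positivity
  set F : ℝ → ℝ := fun x => f 0 + ∫ s in (0:ℝ)..x, g s with hF
  have hFd : ∀ x, HasDerivAt F (g x) x := fun x =>
    (intervalIntegral.integral_hasDerivAt_right (hg.intervalIntegrable _ _)
      (hg.stronglyMeasurableAtFilter _ _) hg.continuousAt).const_add _
  have hFc : ContDiff ℝ 1 F := by
    rw [contDiff_one_iff_deriv]
    refine ⟨fun x => (hFd x).differentiableAt, ?_⟩
    have : deriv F = g := funext fun x => (hFd x).deriv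
    rw [this]; exact hg
  have h0 : ∀ i ∈ Finset.range M, ∫ s in nd M i..nd M (i+1), f s = ∫ s in nd M i..nd M (i+1), F s := by
    intro i hi
    refine intervalIntegral.integral_congr fun x hx => hfg x ?_
    rw [uIcc_of_le (nd_le i)] at hx
    exact (cell_subset hM (Finset.mem_range.1 hi) (Finset.mem_range.1 hi)
      (show (x, x) ∈ _ from ⟨hx, hx⟩)).1
  have h1 : ∫ x in (0:ℝ)..1, f x ^ 2 = ∫ x in (0:ℝ)..1, F x ^ 2 := by
    refine intervalIntegral.integral_congr fun x hx => ?_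
    rw [uIcc_of_le zero_le_one] at hx
    simp only [hfg x hx, hF]
  rw [h1, Finset.sum_congr rfl fun i hi => by rw [h0 i hi]]
  have hw := hinterp (fun x => F x.1) (hFc.comp contDiff_fst)
  have hr : ∫ x in UnitSquare, ‖fderiv ℝ (fun x : ℝ × ℝ => F x.1) x‖ ^ 2
      ≤ ∫ x in (0:ℝ)..1, g x ^ 2 := by
    rw [← us_fst (fun x => g x ^ 2)]
    have hfd : ∀ x : ℝ × ℝ, fderiv ℝ (fun x : ℝ × ℝ => F x.1) x
        = g x.1 • ContinuousLinearMap.fst ℝ ℝ ℝ := fun x =>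
      ((hFd x.1).comp_hasFDerivAt x hasFDerivAt_fst).fderiv
    refine us_integral_mono (us_integrable ?_) (us_integrable ?_) fun x _ => ?_
    · simp_rw [hfd]; fun_prop
    · fun_prop
    · rw [hfd, norm_smul, mul_pow, Real.norm_eq_abs, sq_abs]
      have : ‖ContinuousLinearMap.fst ℝ ℝ ℝ‖ ≤ 1 := ContinuousLinearMap.norm_fst_le ℝ ℝ ℝ
      have h2 : ‖ContinuousLinearMap.fst ℝ ℝ ℝ‖ ^ 2 ≤ 1 := pow_le_one₀ (norm_nonneg _) this
      exact mul_le_of_le_one_right (sq_nonneg _) h2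
  have hca : ∀ x : ℝ × ℝ, cellAvg M (fun x => F x.1) x
      = M * ∫ s in nd M (idx M x.1)..nd M (idx M x.1 + 1), F s := by
    intro x
    rw [cell_prod, prod_int (W := fun x => F x.1) (hFc.continuous.comp continuous_fst)
      (nd_le _) (nd_le _)]
    simp only [Function.comp_def, intervalIntegral.integral_const, nd_len, smul_eq_mul,
      intervalIntegral.integral_const_mul]
    field_simp
  have hl : ∫ x in UnitSquare, (F x.1 - cellAvg M (fun x => F x.1) x) ^ 2
      = (∫ x in (0:ℝ)..1, F x ^ 2)
        - M * ∑ i ∈ Finset.range M, (∫ s in nd M i..nd M (i+1), F s) ^ 2 := by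
    simp_rw [hca]
    rw [us_fst (fun x => (F x - M * ∫ s in nd M (idx M x)..nd M (idx M x + 1), F s) ^ 2),
      sum_idx hM (G := fun x i => (F x - M * ∫ s in nd M i..nd M (i + 1), F s) ^ 2)
      (fun i => by have := hFc.continuous; fun_prop)]
    simp_rw [cell_expand hM hFc.continuous]
    rw [Finset.sum_sub_distrib, sum_cells hM (f := fun x => F x ^ 2) (hFc.continuous.pow 2),
      Finset.mul_sum]
  rw [hl] at hw
  exact hw.trans (mul_le_mul_of_nonneg_left hr hc)

lemma two_dim {M : ℕ} (hM : 1 ≤ M) {c : ℝ} (hc : 0 ≤ c)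
    (hinterp : ∀ w : ℝ × ℝ → ℝ, ContDiff ℝ 1 w →
      (∫ x in UnitSquare, (w x - cellAvg M w x) ^ 2) ≤
        c * ∫ x in UnitSquare, ‖fderiv ℝ w x‖ ^ 2)
    {W A B : ℝ × ℝ → ℝ} (hW : Continuous W) (hA : Continuous A) (hB : Continuous B)
    (hWA : ∀ y, ∀ x ∈ Icc (0:ℝ) 1, W (x, y) = W (0, y) + ∫ s in (0:ℝ)..x, A (s, y))
    (hWB : ∀ x, ∀ y ∈ Icc (0:ℝ) 1, W (x, y) = W (x, 0) + ∫ s in (0:ℝ)..y, B (x, s)) :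
    (∫ x in (0:ℝ)..1, ∫ y in (0:ℝ)..1, W (x, y) ^ 2)
      - M ^ 2 * ∑ i ∈ Finset.range M, ∑ j ∈ Finset.range M,
        (∫ x in nd M i..nd M (i+1), ∫ y in nd M j..nd M (j+1), W (x, y)) ^ 2
      ≤ c * ((∫ x in (0:ℝ)..1, ∫ y in (0:ℝ)..1, A (x, y) ^ 2)
        + ∫ x in (0:ℝ)..1, ∫ y in (0:ℝ)..1, B (x, y) ^ 2) := by
  have hM' : (0:ℝ) < M := by positivity
  -- first direction
  have s1 : (∫ x in (0:ℝ)..1, ((∫ y in (0:ℝ)..1, W (x, y) ^ 2)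
      - M * ∑ j ∈ Finset.range M, (∫ y in nd M j..nd M (j+1), W (x, y)) ^ 2))
      ≤ ∫ x in (0:ℝ)..1, c * ∫ y in (0:ℝ)..1, B (x, y) ^ 2 := by
    refine intervalIntegral.integral_mono_on zero_le_one
      (Continuous.intervalIntegrable (by fun_prop) _ _)
      (Continuous.intervalIntegrable (by fun_prop) _ _) fun x _ => ?_
    exact one_dim hM hc hinterp (f := fun y => W (x, y)) (g := fun y => B (x, y)) (by fun_prop)
      (hWB x)
  rw [intervalIntegral.integral_sub (Continuous.intervalIntegrable (by fun_prop) _ _)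
      (Continuous.intervalIntegrable (by fun_prop) _ _), intervalIntegral.integral_const_mul,
      intervalIntegral.integral_const_mul, intervalIntegral.integral_finsetSum
      (fun j _ => Continuous.intervalIntegrable (by fun_prop) _ _)] at s1
  -- second direction
  have s2 : ∀ j ∈ Finset.range M,
      M * ((∫ x in (0:ℝ)..1, (∫ y in nd M j..nd M (j+1), W (x, y)) ^ 2)
      - M * ∑ i ∈ Finset.range M,
        (∫ x in nd M i..nd M (i+1), ∫ y in nd M j..nd M (j+1), W (x, y)) ^ 2)
      ≤ c * ∫ y in nd M j..nd M (j+1), ∫ x in (0:ℝ)..1, A (x, y) ^ 2 := by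
    intro j _
    have h1 := one_dim hM hc hinterp (f := fun x => ∫ y in nd M j..nd M (j+1), W (x, y))
      (g := fun x => ∫ y in nd M j..nd M (j+1), A (x, y)) (by fun_prop) (by
        intro x hx
        rw [intervalIntegral_intervalIntegral_swap, ← intervalIntegral.integral_add]
        · exact intervalIntegral.integral_congr fun y _ => hWA y x hx
        · exact Continuous.intervalIntegrable (by fun_prop) _ _
        · exact Continuous.intervalIntegrable (by fun_prop) _ _
        · refine IntegrableOn.mono_set (t := uIcc 0 x ×ˢ uIcc (nd M j) (nd M (j+1)))
            (ContinuousOn.integrableOn_compact (isCompact_uIcc.prod isCompact_uIcc) ?_)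
            (prod_mono uIoc_subset_uIcc uIoc_subset_uIcc)
          exact hA.continuousOn)
    have h2 : M * ∫ x in (0:ℝ)..1, (∫ y in nd M j..nd M (j+1), A (x, y)) ^ 2
        ≤ ∫ x in (0:ℝ)..1, ∫ y in nd M j..nd M (j+1), A (x, y) ^ 2 := by
      rw [← intervalIntegral.integral_const_mul]
      refine intervalIntegral.integral_mono_on zero_le_one
        (Continuous.intervalIntegrable (by fun_prop) _ _)
        (Continuous.intervalIntegrable (by fun_prop) _ _) fun x _ => ?_
      exact cell_cs hM (f := fun y => A (x, y)) (by fun_prop) j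
    rw [intervalIntegral_intervalIntegral_swap] at h2
    · have h3 := mul_le_mul_of_nonneg_left h1 hM'.le
      have h4 := mul_le_mul_of_nonneg_left h2 hc
      linarith
    · refine IntegrableOn.mono_set (t := uIcc 0 1 ×ˢ uIcc (nd M j) (nd M (j+1)))
        (ContinuousOn.integrableOn_compact (isCompact_uIcc.prod isCompact_uIcc) ?_)
        (prod_mono uIoc_subset_uIcc uIoc_subset_uIcc)
      exact (hA.pow 2).continuousOn
  have s3 := Finset.sum_le_sum s2
  rw [← Finset.mul_sum, ← Finset.mul_sum, sum_cells hM (f := fun y => ∫ x in (0:ℝ)..1, A (x, y) ^ 2)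
    (by fun_prop), Finset.sum_sub_distrib, ← Finset.mul_sum, Finset.sum_comm] at s3
  rw [intervalIntegral_intervalIntegral_swap (F := fun y x => A (x, y) ^ 2)] at s3
  · linarith
  · refine IntegrableOn.mono_set (t := uIcc (0:ℝ) 1 ×ˢ uIcc (0:ℝ) 1)
        (ContinuousOn.integrableOn_compact (isCompact_uIcc.prod isCompact_uIcc) ?_)
        (prod_mono uIoc_subset_uIcc uIoc_subset_uIcc)
    have : Continuous (Function.uncurry fun y x => A (x, y) ^ 2) := by
      unfold Function.uncurry; fun_prop
    exact this.continuousOn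


/-- clamping to the unit square -/
noncomputable def clamp (p : ℝ × ℝ) : ℝ × ℝ := (max 0 (min 1 p.1), max 0 (min 1 p.2))

lemma cl_mem (x : ℝ) : max 0 (min 1 x) ∈ Icc (0:ℝ) 1 := by
  constructor
  · exact le_max_left _ _
  · exact max_le zero_le_one (min_le_left _ _)

lemma cl_eq {x : ℝ} (hx : x ∈ Icc (0:ℝ) 1) : max 0 (min 1 x) = x := by
  rw [min_eq_right hx.2, max_eq_right hx.1]

lemma clamp_mem (p : ℝ × ℝ) : clamp p ∈ UnitSquare := ⟨cl_mem _, cl_mem _⟩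

lemma clamp_eq {p : ℝ × ℝ} (hp : p ∈ UnitSquare) : clamp p = p := by
  obtain ⟨h1, h2⟩ := hp
  unfold clamp; rw [cl_eq h1, cl_eq h2]

lemma clamp_cont : Continuous clamp := by unfold clamp; fun_prop

lemma clamp_comp {g : ℝ × ℝ → ℝ} (hg : ContinuousOn g UnitSquare) :
    Continuous (fun p => g (clamp p)) :=
  hg.comp_continuous clamp_cont clamp_mem

lemma us_bdd_integrable {f : ℝ × ℝ → ℝ} (hf : AEStronglyMeasurable f (volume.restrict UnitSquare))
    {C : ℝ} (h : ∀ x ∈ UnitSquare, |f x| ≤ C) : IntegrableOn f UnitSquare :=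
  ⟨hf, HasFiniteIntegral.restrict_of_bounded (C := C) us_compact.measure_lt_top
    (ae_restrict_of_forall_mem us_meas h)⟩

lemma us_aesm {g : ℝ × ℝ → ℝ} (hg : ContinuousOn g UnitSquare) :
    AEStronglyMeasurable g (volume.restrict UnitSquare) :=
  hg.aestronglyMeasurable us_meas

lemma us_bdd {g : ℝ × ℝ → ℝ} (hg : ContinuousOn g UnitSquare) :
    ∃ C, ∀ x ∈ UnitSquare, |g x| ≤ C := us_compact.exists_bound_of_continuousOn hg

lemma slice_x {w : ℝ × ℝ → ℝ} (hw : ContDiffOn ℝ 1 w UnitSquare) {y : ℝ}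
    (hy : y ∈ Icc (0:ℝ) 1) {x : ℝ} (hx : x ∈ Icc (0:ℝ) 1) :
    w (x, y) = w (0, y) + ∫ s in (0:ℝ)..x, pdx w (s, y) := by
  have hmap : MapsTo (fun s : ℝ => (s, y)) (Icc 0 1) UnitSquare := fun s hs => ⟨hs, hy⟩
  have hc : ContinuousOn (fun s : ℝ => (s, y)) (Icc 0 1) := by fun_prop
  rw [intervalIntegral.integral_eq_sub_of_hasDerivAt_of_le (f := fun s => w (s, y)) hx.1]
  · ring
  · exact (hw.continuousOn.comp hc hmap).mono (Icc_subset_Icc_right hx.2)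
  · intro s hs
    have hs' : s ∈ Icc (0:ℝ) 1 := ⟨hs.1.le, hs.2.le.trans hx.2⟩
    have h1 := (hw.differentiableOn (by norm_num) _ (hmap hs')).hasFDerivWithinAt
    have h2 : HasDerivWithinAt (fun s : ℝ => (s, y)) ((1:ℝ), (0:ℝ)) (Icc 0 1) s :=
      ((hasDerivAt_id s).prodMk (hasDerivAt_const s y)).hasDerivWithinAt
    exact (h1.comp_hasDerivWithinAt s h2 hmap).hasDerivAt
      (Icc_mem_nhds hs.1 (hs.2.trans_le hx.2))
  · refine ContinuousOn.intervalIntegrable ?_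
    rw [uIcc_of_le hx.1]
    exact ((pdx_cont hw).comp hc hmap).mono (Icc_subset_Icc_right hx.2)

lemma slice_y {w : ℝ × ℝ → ℝ} (hw : ContDiffOn ℝ 1 w UnitSquare) {y : ℝ}
    (hy : y ∈ Icc (0:ℝ) 1) {x : ℝ} (hx : x ∈ Icc (0:ℝ) 1) :
    w (y, x) = w (y, 0) + ∫ s in (0:ℝ)..x, pdy w (y, s) := by
  have hmap : MapsTo (fun s : ℝ => (y, s)) (Icc 0 1) UnitSquare := fun s hs => ⟨hy, hs⟩
  have hc : ContinuousOn (fun s : ℝ => (y, s)) (Icc 0 1) := by fun_prop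
  rw [intervalIntegral.integral_eq_sub_of_hasDerivAt_of_le (f := fun s => w (y, s)) hx.1]
  · ring
  · exact (hw.continuousOn.comp hc hmap).mono (Icc_subset_Icc_right hx.2)
  · intro s hs
    have hs' : s ∈ Icc (0:ℝ) 1 := ⟨hs.1.le, hs.2.le.trans hx.2⟩
    have h1 := (hw.differentiableOn (by norm_num) _ (hmap hs')).hasFDerivWithinAt
    have h2 : HasDerivWithinAt (fun s : ℝ => (y, s)) ((0:ℝ), (1:ℝ)) (Icc 0 1) s :=
      ((hasDerivAt_const s y).prodMk (hasDerivAt_id s)).hasDerivWithinAt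
    exact (h1.comp_hasDerivWithinAt s h2 hmap).hasDerivAt
      (Icc_mem_nhds hs.1 (hs.2.trans_le hx.2))
  · refine ContinuousOn.intervalIntegrable ?_
    rw [uIcc_of_le hx.1]
    exact ((pdy_cont hw).comp hc hmap).mono (Icc_subset_Icc_right hx.2)

lemma interp_cont {M : ℕ} (hM : 1 ≤ M) {W : ℝ × ℝ → ℝ} (hW : Continuous W) :
    ∫ x in UnitSquare, (W x - cellAvg M W x) ^ 2
      = (∫ x in (0:ℝ)..1, ∫ y in (0:ℝ)..1, W (x, y) ^ 2)
      - M ^ 2 * ∑ i ∈ Finset.range M, ∑ j ∈ Finset.range M,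
        (∫ x in nd M i..nd M (i+1), ∫ y in nd M j..nd M (j+1), W (x, y)) ^ 2 := by
  have hM' : (M:ℝ) ≠ 0 := by positivity
  obtain ⟨C, hC⟩ := us_bdd hW.continuousOn
  have hint : IntegrableOn (fun x => (W x - cellAvg M W x) ^ 2) UnitSquare := by
    refine us_bdd_integrable (C := (C + C) ^ 2) ?_ ?_
    · exact (((us_aesm hW.continuousOn).sub
        (cellAvg_meas W).aestronglyMeasurable).pow 2)
    · intro x hx
      rw [abs_pow]
      gcongr
      exact (abs_sub _ _).trans (add_le_add (hC x hx) (cellAvg_bound hM hC x))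
  set Q : ℕ → ℕ → ℝ := fun i j => ∫ x in nd M i..nd M (i+1), ∫ y in nd M j..nd M (j+1), W (x, y)
    with hQ
  have hca : ∀ x y : ℝ, cellAvg M W (x, y) = M ^ 2 * Q (idx M x) (idx M y) := by
    intro x y
    rw [cell_prod, prod_int hW (nd_le _) (nd_le _)]
  rw [UnitSquare, Measure.volume_eq_prod, setIntegral_prod _ hint]
  simp_rw [integral_Icc_eq_integral_Ioc, ← intervalIntegral.integral_of_le (zero_le_one' ℝ), hca]
  have e1 : ∀ x : ℝ, ∫ y in (0:ℝ)..1, (W (x, y) - M ^ 2 * Q (idx M x) (idx M y)) ^ 2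
      = ∑ j ∈ Finset.range M, ∫ y in nd M j..nd M (j+1),
        (W (x, y) - M ^ 2 * Q (idx M x) j) ^ 2 := fun x =>
    sum_idx hM (G := fun y j => (W (x, y) - M ^ 2 * Q (idx M x) j) ^ 2) (fun j => by fun_prop)
  simp_rw [e1]
  rw [sum_idx hM (G := fun x i => ∑ j ∈ Finset.range M, ∫ y in nd M j..nd M (j+1),
        (W (x, y) - M ^ 2 * Q i j) ^ 2) (fun j => by fun_prop)]
  have e2 : ∀ i j : ℕ, ∫ x in nd M i..nd M (i+1), ∫ y in nd M j..nd M (j+1),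
        (W (x, y) - M ^ 2 * Q i j) ^ 2
      = (∫ x in nd M i..nd M (i+1), ∫ y in nd M j..nd M (j+1), W (x, y) ^ 2)
        - M ^ 2 * Q i j ^ 2 := by
    intro i j
    have a : ∀ x, ∫ y in nd M j..nd M (j+1), (W (x, y) - M ^ 2 * Q i j) ^ 2
        = (∫ y in nd M j..nd M (j+1), W (x, y) ^ 2)
          - (2 * (M ^ 2 * Q i j)) * (∫ y in nd M j..nd M (j+1), W (x, y))
          + (M ^ 2 * Q i j) ^ 2 / M := by
      intro x
      have : ∀ y, (W (x, y) - M ^ 2 * Q i j) ^ 2 = W (x, y) ^ 2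
          - (2 * (M ^ 2 * Q i j)) * W (x, y) + (M ^ 2 * Q i j) ^ 2 := fun y => by ring
      simp_rw [this]
      rw [intervalIntegral.integral_add (Continuous.intervalIntegrable (by fun_prop) _ _)
        (Continuous.intervalIntegrable (by fun_prop) _ _), intervalIntegral.integral_sub
        (Continuous.intervalIntegrable (by fun_prop) _ _)
        (Continuous.intervalIntegrable (by fun_prop) _ _), intervalIntegral.integral_const_mul,
        intervalIntegral.integral_const, nd_len]
      simp only [smul_eq_mul]; ring
    simp_rw [a]
    rw [intervalIntegral.integral_add (Continuous.intervalIntegrable (by fun_prop) _ _)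
        (Continuous.intervalIntegrable (by fun_prop) _ _), intervalIntegral.integral_sub
        (Continuous.intervalIntegrable (by fun_prop) _ _)
        (Continuous.intervalIntegrable (by fun_prop) _ _), intervalIntegral.integral_const_mul,
        intervalIntegral.integral_const, nd_len]
    have : ∫ x in nd M i..nd M (i+1), ∫ y in nd M j..nd M (j+1), W (x, y) = Q i j := rfl
    rw [this]
    simp only [smul_eq_mul]
    field_simp
    ring
  have e3 : ∀ i : ℕ, ∫ x in nd M i..nd M (i+1), ∑ j ∈ Finset.range M,
      ∫ y in nd M j..nd M (j+1), (W (x, y) - M ^ 2 * Q i j) ^ 2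
      = (∫ x in nd M i..nd M (i+1), ∫ y in (0:ℝ)..1, W (x, y) ^ 2)
        - M ^ 2 * ∑ j ∈ Finset.range M, Q i j ^ 2 := by
    intro i
    rw [intervalIntegral.integral_finsetSum
      (fun j _ => Continuous.intervalIntegrable (by fun_prop) _ _)]
    simp_rw [e2]
    rw [Finset.sum_sub_distrib, ← Finset.mul_sum, ← intervalIntegral.integral_finsetSum
      (fun j _ => Continuous.intervalIntegrable (by fun_prop) _ _)]
    congr 1
    refine intervalIntegral.integral_congr fun x _ => ?_
    exact sum_cells hM (f := fun y => W (x, y) ^ 2) (by fun_prop)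
  simp_rw [e3]
  rw [Finset.sum_sub_distrib, ← Finset.mul_sum,
    sum_cells hM (f := fun x => ∫ y in (0:ℝ)..1, W (x, y) ^ 2) (by fun_prop)]

lemma interp {M : ℕ} (hM : 1 ≤ M) {c : ℝ} (hc : 0 ≤ c)
    (hinterp : ∀ w : ℝ × ℝ → ℝ, ContDiff ℝ 1 w →
      (∫ x in UnitSquare, (w x - cellAvg M w x) ^ 2) ≤
        c * ∫ x in UnitSquare, ‖fderiv ℝ w x‖ ^ 2)
    {w : ℝ × ℝ → ℝ} (hw : ContDiffOn ℝ 1 w UnitSquare) :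
    ∫ x in UnitSquare, (w x - cellAvg M w x) ^ 2
      ≤ c * ∫ x in UnitSquare, (pdx w x ^ 2 + pdy w x ^ 2) := by
  have cW := clamp_comp hw.continuousOn
  have cA := clamp_comp (pdx_cont hw)
  have cB := clamp_comp (pdy_cont hw)
  have h := two_dim hM hc hinterp cW cA cB ?_ ?_
  · rw [← interp_cont hM cW] at h
    have e1 : ∫ x in UnitSquare, (w x - cellAvg M w x) ^ 2
        = ∫ x in UnitSquare, (w (clamp x) - cellAvg M (fun p => w (clamp p)) x) ^ 2 := by
      refine setIntegral_congr_fun us_meas fun x hx => ?_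
      simp only [clamp_eq hx]
      rw [cellAvg_congr hM (w := w) (z := fun p => w (clamp p))
        (fun y hy => by simp only [clamp_eq hy])]
    have e2 : ∫ x in UnitSquare, (pdx w x ^ 2 + pdy w x ^ 2)
        = ∫ x in UnitSquare, (pdx w (clamp x) ^ 2 + pdy w (clamp x) ^ 2) := by
      refine setIntegral_congr_fun us_meas fun x hx => ?_
      simp only [clamp_eq hx]
    have cA2 : Continuous (fun p => pdx w (clamp p) ^ 2) := cA.pow 2
    have cB2 : Continuous (fun p => pdy w (clamp p) ^ 2) := cB.pow 2
    have e3 : ∫ x in UnitSquare, pdx w (clamp x) ^ 2 = _ :=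
      prod_int cA2 zero_le_one zero_le_one
    have e4 : ∫ x in UnitSquare, pdy w (clamp x) ^ 2 = _ :=
      prod_int cB2 zero_le_one zero_le_one
    rw [e1, e2, integral_add (us_integrable cA2.continuousOn)
      (us_integrable cB2.continuousOn), e3, e4]
    exact h
  · intro y x hx
    have h0 : (0:ℝ) ∈ Icc (0:ℝ) 1 := by simp
    have := slice_x hw (cl_mem y) hx
    simp only [clamp, cl_eq hx, cl_eq h0]
    rw [this]
    congr 1
    refine intervalIntegral.integral_congr fun s hs => ?_
    rw [uIcc_of_le hx.1] at hs
    simp only [cl_eq (show s ∈ Icc (0:ℝ) 1 from ⟨hs.1, hs.2.trans hx.2⟩)]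
  · intro y x hx
    have h0 : (0:ℝ) ∈ Icc (0:ℝ) 1 := by simp
    have := slice_y hw (cl_mem y) hx
    simp only [clamp, cl_eq hx, cl_eq h0]
    rw [this]
    congr 1
    refine intervalIntegral.integral_congr fun s hs => ?_
    rw [uIcc_of_le hx.1] at hs
    simp only [cl_eq (show s ∈ Icc (0:ℝ) 1 from ⟨hs.1, hs.2.trans hx.2⟩)]

lemma mul_cellAvg_integrable {M : ℕ} (hM : 1 ≤ M) {w z : ℝ × ℝ → ℝ}
    (hw : ContinuousOn w UnitSquare) (hz : ContinuousOn z UnitSquare) :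
    IntegrableOn (fun x => z x * cellAvg M w x) UnitSquare := by
  obtain ⟨C, hC⟩ := us_bdd hw
  obtain ⟨C', hC'⟩ := us_bdd hz
  refine us_bdd_integrable (C := C' * C) ((us_aesm hz).mul
    (cellAvg_meas w).aestronglyMeasurable) fun x hx => ?_
  rw [abs_mul]
  exact mul_le_mul (hC' x hx) (cellAvg_bound hM hC x) (abs_nonneg _)
    ((abs_nonneg _).trans (hC' x hx))

lemma cellAvg_sq_integrable {M : ℕ} (hM : 1 ≤ M) {w : ℝ × ℝ → ℝ}
    (hw : ContinuousOn w UnitSquare) :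
    IntegrableOn (fun x => cellAvg M w x ^ 2) UnitSquare := by
  obtain ⟨C, hC⟩ := us_bdd hw
  refine us_bdd_integrable (C := C ^ 2)
    ((cellAvg_meas w).aestronglyMeasurable.pow 2) fun x hx => ?_
  rw [abs_pow]
  exact pow_le_pow_left₀ (abs_nonneg _) (cellAvg_bound hM hC x) 2

lemma lapl_mul_integrable {w z : ℝ × ℝ → ℝ} (hw : ContDiffOn ℝ 2 w UnitSquare)
    (hz : ContinuousOn z UnitSquare) : IntegrableOn (fun x => z x * lapl w x) UnitSquare :=
  us_integrable_congr (f := fun x => z x * (pdx (pdx w) x + pdy (pdy w) x))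
    (fun x hx => by simp only [lapl_eq hw hx]) (us_integrable (hz.mul (lapl_cont hw)))

/-- coercivity of diffusion plus nudging -/
lemma coercive {M : ℕ} (hM : 1 ≤ M) {c d μ ε : ℝ} (hc : 0 ≤ c) (hμ : 0 ≤ μ) (hε : 0 < ε)
    (hd : ε * μ * c ≤ d)
    (hinterp : ∀ w : ℝ × ℝ → ℝ, ContDiff ℝ 1 w →
      (∫ x in UnitSquare, (w x - cellAvg M w x) ^ 2) ≤
        c * ∫ x in UnitSquare, ‖fderiv ℝ w x‖ ^ 2)
    {w : ℝ × ℝ → ℝ} (hw : ContDiffOn ℝ 2 w UnitSquare) (nw : NeumannBC w) :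
    d * (∫ x in UnitSquare, w x * lapl w x) - μ * ∫ x in UnitSquare, w x * cellAvg M w x
      ≤ - (μ * (1 - 1 / (4 * ε))) * ∫ x in UnitSquare, w x ^ 2 := by
  have h1 : ∫ x in UnitSquare, w x * lapl w x
      = - ∫ x in UnitSquare, (pdx w x ^ 2 + pdy w x ^ 2) := by
    rw [← green hw nw]
    exact us_integral_congr fun x hx => by rw [lapl_eq hw hx]
  have hi := interp hM hc hinterp (hw.of_le (by norm_num) : ContDiffOn ℝ 1 w UnitSquare)
  have c0 := hw.continuousOn
  have i1 := mul_cellAvg_integrable hM c0 c0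
  have i2 := cellAvg_sq_integrable hM c0
  have i3 : IntegrableOn (fun x => w x ^ 2) UnitSquare := us_integrable (c0.pow 2)
  have hG : 0 ≤ ∫ x in UnitSquare, (pdx w x ^ 2 + pdy w x ^ 2) :=
    setIntegral_nonneg us_meas fun x _ => by positivity
  have i4 : IntegrableOn (fun x => (w x - cellAvg M w x) ^ 2) UnitSquare := by
    have : (fun x => (w x - cellAvg M w x) ^ 2)
        = fun x => w x ^ 2 - 2 * (w x * cellAvg M w x) + cellAvg M w x ^ 2 := by
      funext x; ring
    rw [this]
    exact (i3.sub (i1.const_mul 2)).add i2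
  -- Young
  have hy : (1 - 1 / (4 * ε)) * (∫ x in UnitSquare, w x ^ 2)
      - ε * (∫ x in UnitSquare, (w x - cellAvg M w x) ^ 2)
      ≤ ∫ x in UnitSquare, w x * cellAvg M w x := by
    rw [← integral_const_mul, ← integral_const_mul, ← integral_sub (i3.const_mul _)
      (i4.const_mul _)]
    refine us_integral_mono ((i3.const_mul _).sub (i4.const_mul _)) i1 fun x _ => ?_
    have : 0 ≤ (w x / (2 * ε) - (w x - cellAvg M w x)) ^ 2 * ε := by positivity
    have e : (w x / (2 * ε) - (w x - cellAvg M w x)) ^ 2 * ε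
       = w x * cellAvg M w x - ((1 - 1 / (4 * ε)) * w x ^ 2
        - ε * (w x - cellAvg M w x) ^ 2) := by
      field_simp; ring
    linarith
  rw [h1]
  set G := ∫ x in UnitSquare, (pdx w x ^ 2 + pdy w x ^ 2)
  have a1 := mul_le_mul_of_nonneg_left hy hμ
  have a2 := mul_le_mul_of_nonneg_left hi (mul_nonneg hε.le hμ)
  have a3 := mul_le_mul_of_nonneg_right hd hG
  linarith


lemma energy_right_deriv {d G C t0 : ℝ} (hd : 0 < d) (ht0 : 0 < t0) {w : ℝ → ℝ × ℝ → ℝ}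
    (hreg : ClassicalReg w) (hN : ∀ t, 0 < t → NeumannBC (w t)) {g : ℝ → ℝ × ℝ → ℝ}
    (hpde : ∀ t, 0 < t → ∀ x ∈ interior UnitSquare,
      HasDerivAt (fun s => w s x) (d * lapl (w t) x + g t x) t)
    (hg : ∀ t, 0 < t → ∀ x ∈ interior UnitSquare, |g t x| ≤ G)
    (hC : ∀ t, 0 ≤ t → ∀ x ∈ UnitSquare, |w t x| ≤ C) :
    HasDerivWithinAt (fun t => ∫ x in UnitSquare, (w t x) ^ 2)
      (∫ x in UnitSquare, 2 * w t0 x * (d * lapl (w t0) x + g t0 x)) (Ici t0) t0 := by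
  obtain ⟨K, hK⟩ := lip hd ht0 hreg hN hpde hg
  rw [← hasDerivWithinAt_Ioi_iff_Ici, hasDerivWithinAt_iff_tendsto_slope' (by simp)]
  have hc : ∀ t, 0 < t → ContinuousOn (w t) UnitSquare := fun t ht => (hreg.2 t ht).continuousOn
  have hsl : ∀ t, t0 < t → slope (fun t => ∫ x in UnitSquare, (w t x) ^ 2) t0 t
      = ∫ x in UnitSquare, (t - t0)⁻¹ * ((w t x) ^ 2 - (w t0 x) ^ 2) := by
    intro t ht
    have j1 : IntegrableOn (fun x => w t x ^ 2) UnitSquare :=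
      us_integrable ((hc t (ht0.trans ht)).pow 2)
    have j2 : IntegrableOn (fun x => w t0 x ^ 2) UnitSquare :=
      us_integrable ((hc t0 ht0).pow 2)
    rw [slope_def_module, integral_const_mul, integral_sub j1 j2, smul_eq_mul]
  have hmem : ∀ᶠ t in 𝓝[>] t0, t0 < t := self_mem_nhdsWithin
  have key : Tendsto (fun t => ∫ x in UnitSquare, (t - t0)⁻¹ * ((w t x) ^ 2 - (w t0 x) ^ 2))
      (𝓝[>] t0) (𝓝 (∫ x in UnitSquare, 2 * w t0 x * (d * lapl (w t0) x + g t0 x))) := by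
    refine tendsto_integral_filter_of_dominated_convergence (fun _ => K * (2 * C)) ?_ ?_ ?_ ?_
    · filter_upwards [hmem] with t ht
      exact us_aesm (continuousOn_const.mul
        (((hc t (ht0.trans ht)).pow 2).sub ((hc t0 ht0).pow 2)))
    · filter_upwards [hmem] with t ht
      refine (ae_restrict_iff' us_meas).2 (Eventually.of_forall fun x hx => ?_)
      have h1 := hK t ht.le x hx
      have h2 := hC t (ht0.trans ht).le x hx
      have h3 := hC t0 ht0.le x hx
      have hpos : 0 < t - t0 := sub_pos.2 ht
      have h4 : |w t x + w t0 x| ≤ 2 * C := (abs_add_le _ _).trans (by linarith)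
      rw [Real.norm_eq_abs, abs_mul, abs_inv, abs_of_pos hpos, sq_sub_sq, abs_mul]
      rw [inv_mul_le_iff₀ hpos]
      have := mul_le_mul h4 h1 (abs_nonneg _) ((abs_nonneg _).trans h4)
      linarith
    · exact us_integrable (g := fun _ => K * (2 * C)) continuousOn_const
    · rw [us_restrict]
      refine (ae_restrict_iff' isOpen_interior.measurableSet).2
        (Eventually.of_forall fun x hx => ?_)
      have h := ((hpde t0 ht0 x hx).pow 2).hasDerivWithinAt (s := Ioi t0)
      rw [hasDerivWithinAt_iff_tendsto_slope' (by simp)] at h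
      convert h using 2
      · simp [slope_def_module]
      · simp
  refine key.congr' ?_
  filter_upwards [hmem] with t ht
  exact (hsl t ht).symm

lemma energy_cont {C : ℝ} {w : ℝ → ℝ × ℝ → ℝ}
    (hreg : ClassicalReg w)
    (hC : ∀ t, 0 ≤ t → ∀ x ∈ UnitSquare, |w t x| ≤ C) :
    ContinuousOn (fun t => ∫ x in UnitSquare, (w t x) ^ 2) (Ici 0) := by
  have hc : ∀ t, 0 ≤ t → ContinuousOn (w t) UnitSquare := fun t ht =>
    hreg.1.comp (f := fun x => (t, x)) (by fun_prop) (fun x hx => ⟨ht, hx⟩)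
  have hct : ∀ x ∈ UnitSquare, ContinuousOn (fun t => w t x) (Ici 0) := fun x hx =>
    hreg.1.comp (f := fun t : ℝ => (t, x)) (by fun_prop) (fun t ht => ⟨ht, hx⟩)
  refine continuousOn_of_dominated (bound := fun _ => C ^ 2) ?_ ?_ ?_ ?_
  · intro t ht
    exact us_aesm ((hc t ht).pow 2)
  · intro t ht
    refine (ae_restrict_iff' us_meas).2 (Eventually.of_forall fun x hx => ?_)
    rw [Real.norm_eq_abs, abs_pow]
    exact pow_le_pow_left₀ (abs_nonneg _) (hC t ht x hx) 2
  · exact us_integrable (g := fun _ => C ^ 2) continuousOn_const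
  · refine (ae_restrict_iff' us_meas).2 (Eventually.of_forall fun x hx => ?_)
    exact (hct x hx).pow 2

lemma gronwall_right {E E' : ℝ → ℝ} {γ : ℝ} (hE : ContinuousOn E (Ici 0))
    (hd : ∀ t, 0 < t → HasDerivWithinAt E (E' t) (Ici t) t)
    (hle : ∀ t, 0 < t → E' t ≤ -(2 * γ) * E t) {t : ℝ} (ht : 0 ≤ t) :
    E t ≤ E 0 * Real.exp (-(2 * γ * t)) := by
  have hexp : Continuous (fun t : ℝ => Real.exp (2 * γ * t)) := by fun_prop
  have hPc : ContinuousOn (fun t => E t * Real.exp (2 * γ * t)) (Ici 0) :=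
    hE.mul hexp.continuousOn
  have hP : ∀ a, 0 < a → a ≤ t →
      E t * Real.exp (2 * γ * t) ≤ E a * Real.exp (2 * γ * a) := by
    intro a ha hat
    refine image_le_of_deriv_right_le_deriv_boundary
      (f := fun t => E t * Real.exp (2 * γ * t))
      (f' := fun t => E' t * Real.exp (2 * γ * t) + E t * (Real.exp (2 * γ * t) * (2 * γ)))
      (a := a) (b := t) (B := fun _ => E a * Real.exp (2 * γ * a)) (B' := fun _ => 0)
      (hPc.mono fun s hs => ha.le.trans hs.1) ?_ le_rfl continuousOn_const
      (fun x _ => hasDerivWithinAt_const _ _ _) ?_ ⟨hat, le_rfl⟩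
    · intro x hx
      have h2 : HasDerivAt (fun t : ℝ => Real.exp (2 * γ * t))
          (Real.exp (2 * γ * x) * (2 * γ)) x := by
        have := ((hasDerivAt_id x).const_mul (2 * γ)).exp
        simpa using this
      exact (hd x (ha.trans_le hx.1)).mul h2.hasDerivWithinAt
    · intro x hx
      have := hle x (ha.trans_le hx.1)
      have hp := Real.exp_pos (2 * γ * x)
      nlinarith
  rcases ht.eq_or_lt with rfl | ht
  · simp
  have hlim : Tendsto (fun a => E a * Real.exp (2 * γ * a)) (𝓝[>] 0) (𝓝 (E 0)) := by
    have := (hPc 0 (by simp)).tendsto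
    simp only [mul_zero, Real.exp_zero, mul_one] at this
    exact this.mono_left (nhdsWithin_mono _ Ioi_subset_Ici_self)
  have h0 : E t * Real.exp (2 * γ * t) ≤ E 0 := by
    refine ge_of_tendsto hlim ?_
    filter_upwards [Ioc_mem_nhdsGT ht] with a ha
    exact hP a ha.1 ha.2
  rw [Real.exp_neg, ← div_eq_mul_inv, le_div_iff₀ (Real.exp_pos _)]
  exact h0

lemma reg_sub {w z : ℝ → ℝ × ℝ → ℝ} (hw : ClassicalReg w) (hz : ClassicalReg z) :
    ClassicalReg (fun t x => w t x - z t x) :=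
  ⟨hw.1.sub hz.1, fun t ht => (hw.2 t ht).sub (hz.2 t ht)⟩

lemma reg_cont {w : ℝ → ℝ × ℝ → ℝ} (hw : ClassicalReg w) {t : ℝ} (ht : 0 < t) :
    ContinuousOn (w t) UnitSquare := (hw.2 t ht).continuousOn

/-- integral form of the energy identity right-hand side, for one component -/
lemma comp_energy {M : ℕ} (hM : 1 ≤ M) {c d μ ε a : ℝ} (hc : 0 ≤ c) (hμ : 0 ≤ μ) (hε : 0 < ε)
    (hd : ε * μ * c ≤ d)
    (hinterp : ∀ w : ℝ × ℝ → ℝ, ContDiff ℝ 1 w →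
      (∫ x in UnitSquare, (w x - cellAvg M w x) ^ 2) ≤
        c * ∫ x in UnitSquare, ‖fderiv ℝ w x‖ ^ 2)
    {w r : ℝ × ℝ → ℝ} (hw : ContDiffOn ℝ 2 w UnitSquare) (nw : NeumannBC w)
    (hr : ContinuousOn r UnitSquare) :
    ∫ x in UnitSquare, 2 * w x * (d * lapl w x + (r x - a * w x - μ * cellAvg M w x))
      ≤ 2 * (∫ x in UnitSquare, w x * r x)
        - 2 * (a + μ * (1 - 1 / (4 * ε))) * ∫ x in UnitSquare, w x ^ 2 := by
  have hco := coercive hM hc hμ hε hd hinterp hw nw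
  have c0 := hw.continuousOn
  have i1 := lapl_mul_integrable hw c0
  have i2 : IntegrableOn (fun x => w x * r x) UnitSquare := us_integrable (c0.mul hr)
  have i3 : IntegrableOn (fun x => w x ^ 2) UnitSquare := us_integrable (c0.pow 2)
  have i4 := mul_cellAvg_integrable hM c0 c0
  have e : ∫ x in UnitSquare, 2 * w x * (d * lapl w x + (r x - a * w x - μ * cellAvg M w x))
      = 2 * d * (∫ x in UnitSquare, w x * lapl w x) + 2 * (∫ x in UnitSquare, w x * r x)
        - 2 * a * (∫ x in UnitSquare, w x ^ 2)
        - 2 * μ * ∫ x in UnitSquare, w x * cellAvg M w x := by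
    have k1 : IntegrableOn (fun x => 2 * d * (w x * lapl w x)) UnitSquare := i1.const_mul _
    have k2 : IntegrableOn (fun x => 2 * (w x * r x)) UnitSquare := i2.const_mul _
    have k3 : IntegrableOn (fun x => 2 * a * w x ^ 2) UnitSquare := i3.const_mul _
    have k4 : IntegrableOn (fun x => 2 * μ * (w x * cellAvg M w x)) UnitSquare := i4.const_mul _
    have k5 : IntegrableOn (fun x => 2 * d * (w x * lapl w x) + 2 * (w x * r x)) UnitSquare :=
      k1.add k2
    have k6 : IntegrableOn (fun x => 2 * d * (w x * lapl w x) + 2 * (w x * r x)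
      - 2 * a * w x ^ 2) UnitSquare := k5.sub k3
    rw [← integral_const_mul, ← integral_const_mul, ← integral_const_mul, ← integral_const_mul,
      ← integral_add k1 k2, ← integral_sub k5 k3, ← integral_sub k6 k4]
    congr 1
    funext x
    ring
  rw [e]
  linarith

lemma nonlin {u v a b m : ℝ} (hm : 0 ≤ m) (hu : 0 ≤ u ∧ u ≤ 1) (hv : 0 ≤ v ∧ v ≤ m)
    (hb : 0 ≤ b ∧ b ≤ m) :
    (b - v) * (a * b ^ 2 - u * v ^ 2) - (a - u) * (a * b ^ 2 - u * v ^ 2)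
      ≤ 2 * (m ^ 2 + 2 * m) * ((a - u) ^ 2 + (b - v) ^ 2) := by
  obtain ⟨hu0, hu1⟩ := hu
  obtain ⟨hv0, hv1⟩ := hv
  obtain ⟨hb0, hb1⟩ := hb
  have hq : a * b ^ 2 - u * v ^ 2 = (a - u) * b ^ 2 + u * (b + v) * (b - v) := by ring
  rw [hq]
  generalize a - u = e
  generalize b - v = f
  have h1 : 0 ≤ b ^ 2 := sq_nonneg b
  have h2 : b ^ 2 ≤ m ^ 2 := pow_le_pow_left₀ hb0 hb1 2
  have h3 : 0 ≤ u * (b + v) := by positivity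
  have h4 : u * (b + v) ≤ 2 * m := by nlinarith
  generalize b ^ 2 = p at *
  generalize u * (b + v) = q at *
  generalize m ^ 2 = n at *
  have k1 : e * f ≤ (e ^ 2 + f ^ 2) / 2 := by nlinarith [sq_nonneg (e - f)]
  have k2 : -(e * f) ≤ (e ^ 2 + f ^ 2) / 2 := by nlinarith [sq_nonneg (e + f)]
  have s0 : 0 ≤ e ^ 2 := sq_nonneg e
  have s1 : 0 ≤ f ^ 2 := sq_nonneg f
  have l1 : p * (e * f) ≤ p * ((e ^ 2 + f ^ 2) / 2) := mul_le_mul_of_nonneg_left k1 h1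
  have l2 : q * (-(e * f)) ≤ q * ((e ^ 2 + f ^ 2) / 2) := mul_le_mul_of_nonneg_left k2 h3
  have l3 : p * (e ^ 2 + f ^ 2) ≤ n * (e ^ 2 + f ^ 2) :=
    mul_le_mul_of_nonneg_right h2 (by positivity)
  have l4 : q * (e ^ 2 + f ^ 2) ≤ 2 * m * (e ^ 2 + f ^ 2) :=
    mul_le_mul_of_nonneg_right h4 (by positivity)
  have l5 : 0 ≤ p * e ^ 2 := by positivity
  have l6 : q * f ^ 2 ≤ q * (e ^ 2 + f ^ 2) := by nlinarith [mul_nonneg h3 s0]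
  have l7 : 0 ≤ n * (e ^ 2 + f ^ 2) := mul_nonneg (h1.trans h2) (by positivity)
  have l8 : 0 ≤ m * (e ^ 2 + f ^ 2) := mul_nonneg hm (by positivity)
  linarith

end Helpers

/-- Synchronization at the continuous level (Theorem 4.6, classical-solution form). -/
theorem continuous_synchronization
    (du dv F k : ℝ) (hdu : 0 < du) (hdv : 0 < dv) (hF : 0 < F) (hk : 0 < k)
    (μu μv : ℝ) (hμu : 0 ≤ μu) (hμv : 0 ≤ μv)
    (vmax : ℝ) (hvmax : 0 ≤ vmax)
    (M : ℕ) (hM : 1 ≤ M) (H : ℝ) (hH : H = 1 / (M : ℝ))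
    (u v ut vt : ℝ → ℝ × ℝ → ℝ)
    (hreg_u : ClassicalReg u) (hreg_v : ClassicalReg v)
    (hreg_ut : ClassicalReg ut) (hreg_vt : ClassicalReg vt)
    -- the Gray–Scott system for the truth `(u, v)`
    (hpde_u : ∀ t : ℝ, 0 < t → ∀ x ∈ interior UnitSquare,
      HasDerivAt (fun s => u s x)
        (du * lapl (u t) x - u t x * (v t x) ^ 2 + F * (1 - u t x)) t)
    (hpde_v : ∀ t : ℝ, 0 < t → ∀ x ∈ interior UnitSquare,
      HasDerivAt (fun s => v s x)
        (dv * lapl (v t) x + u t x * (v t x) ^ 2 - (F + k) * v t x) t)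
    -- the nudged system for `(ũ, ṽ)`
    (hpde_ut : ∀ t : ℝ, 0 < t → ∀ x ∈ interior UnitSquare,
      HasDerivAt (fun s => ut s x)
        (du * lapl (ut t) x - ut t x * (vt t x) ^ 2 + F * (1 - ut t x)
          + μu * (cellAvg M (u t) x - cellAvg M (ut t) x)) t)
    (hpde_vt : ∀ t : ℝ, 0 < t → ∀ x ∈ interior UnitSquare,
      HasDerivAt (fun s => vt s x)
        (dv * lapl (vt t) x + ut t x * (vt t x) ^ 2 - (F + k) * vt t x
          + μv * (cellAvg M (v t) x - cellAvg M (vt t) x)) t)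
    -- homogeneous Neumann boundary conditions
    (hbc : ∀ t : ℝ, 0 < t →
      NeumannBC (u t) ∧ NeumannBC (v t) ∧ NeumannBC (ut t) ∧ NeumannBC (vt t))
    -- pointwise bounds
    (hub : ∀ t : ℝ, 0 ≤ t → ∀ x ∈ UnitSquare, 0 ≤ u t x ∧ u t x ≤ 1)
    (hutb : ∀ t : ℝ, 0 ≤ t → ∀ x ∈ UnitSquare, 0 ≤ ut t x ∧ ut t x ≤ 1)
    (hvb : ∀ t : ℝ, 0 ≤ t → ∀ x ∈ UnitSquare, 0 ≤ v t x ∧ v t x ≤ vmax)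
    (hvtb : ∀ t : ℝ, 0 ≤ t → ∀ x ∈ UnitSquare, 0 ≤ vt t x ∧ vt t x ≤ vmax)
    -- interpolation constant
    (γ₀ : ℝ) (hγ₀ : 0 < γ₀)
    (hinterp : ∀ w : ℝ × ℝ → ℝ, ContDiff ℝ 1 w →
      (∫ x in UnitSquare, (w x - cellAvg M w x) ^ 2) ≤
        γ₀ * H ^ 2 * ∫ x in UnitSquare, ‖fderiv ℝ w x‖ ^ 2)
    -- conditions relating the gains, the resolution and the diffusion
    (ε : ℝ) (hε : 1 / 4 < ε)
    (hcoer : ε * max μu μv * γ₀ * H ^ 2 ≤ min du dv)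
    (γ : ℝ)
    (hγdef : γ = min (F + μu * (1 - 1 / (4 * ε))) (F + k + μv * (1 - 1 / (4 * ε)))
      - 2 * (vmax ^ 2 + 2 * vmax))
    (hγ : 0 < γ) :
    ∀ t : ℝ, 0 ≤ t →
      (∫ x in UnitSquare, (ut t x - u t x) ^ 2) + (∫ x in UnitSquare, (vt t x - v t x) ^ 2) ≤
        ((∫ x in UnitSquare, (ut 0 x - u 0 x) ^ 2)
          + ∫ x in UnitSquare, (vt 0 x - v 0 x) ^ 2) * Real.exp (-(2 * γ * t)) := by
  have int_us : interior UnitSquare ⊆ UnitSquare := interior_subset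
  set q : ℝ → ℝ × ℝ → ℝ := fun t x => ut t x * (vt t x) ^ 2 - u t x * (v t x) ^ 2 with hq
  have regE := reg_sub hreg_ut hreg_u
  have regF := reg_sub hreg_vt hreg_v
  have nE : ∀ t, 0 < t → NeumannBC (fun x => ut t x - u t x) := fun t ht =>
    neumann_sub (hreg_ut.2 t ht) (hreg_u.2 t ht) (hbc t ht).2.2.1 (hbc t ht).1
  have nF : ∀ t, 0 < t → NeumannBC (fun x => vt t x - v t x) := fun t ht =>
    neumann_sub (hreg_vt.2 t ht) (hreg_v.2 t ht) (hbc t ht).2.2.2 (hbc t ht).2.1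
  have bE : ∀ t, 0 ≤ t → ∀ x ∈ UnitSquare, |ut t x - u t x| ≤ 1 := fun t ht x hx => by
    have h1 := hub t ht x hx
    have h2 := hutb t ht x hx
    rw [abs_le]; constructor <;> linarith
  have bF : ∀ t, 0 ≤ t → ∀ x ∈ UnitSquare, |vt t x - v t x| ≤ vmax := fun t ht x hx => by
    have h1 := hvb t ht x hx
    have h2 := hvtb t ht x hx
    rw [abs_le]; constructor <;> linarith
  have bq : ∀ t, 0 ≤ t → ∀ x ∈ UnitSquare, |q t x| ≤ vmax ^ 2 := fun t ht x hx => by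
    obtain ⟨a1, a2⟩ := hub t ht x hx
    obtain ⟨b1, b2⟩ := hutb t ht x hx
    obtain ⟨c1, c2⟩ := hvb t ht x hx
    obtain ⟨d1, d2⟩ := hvtb t ht x hx
    have p1 : (v t x) ^ 2 ≤ vmax ^ 2 := pow_le_pow_left₀ c1 c2 2
    have p2 : (vt t x) ^ 2 ≤ vmax ^ 2 := pow_le_pow_left₀ d1 d2 2
    have p3 : u t x * (v t x) ^ 2 ≤ 1 * vmax ^ 2 := mul_le_mul a2 p1 (sq_nonneg _) zero_le_one
    have p4 : ut t x * (vt t x) ^ 2 ≤ 1 * vmax ^ 2 := mul_le_mul b2 p2 (sq_nonneg _) zero_le_one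
    have p5 : 0 ≤ u t x * (v t x) ^ 2 := by positivity
    have p6 : 0 ≤ ut t x * (vt t x) ^ 2 := by positivity
    simp only [hq]
    rw [abs_le]; constructor <;> linarith
  have cq : ∀ t, 0 < t → ContinuousOn (q t) UnitSquare := fun t ht =>
    ((reg_cont hreg_ut ht).mul ((reg_cont hreg_vt ht).pow 2)).sub
      ((reg_cont hreg_u ht).mul ((reg_cont hreg_v ht).pow 2))
  have gbound : ∀ {r e a μ m : ℝ} {ca : ℝ}, 0 ≤ a → 0 ≤ μ → |r| ≤ vmax ^ 2 → |e| ≤ m →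
      |ca| ≤ m → |r - a * e - μ * ca| ≤ vmax ^ 2 + a * m + μ * m := by
    intro r e a μ m ca ha hμ hr he hca
    have h1 : |a * e| ≤ a * m := by
      rw [abs_mul, abs_of_nonneg ha]; exact mul_le_mul_of_nonneg_left he ha
    have h2 : |μ * ca| ≤ μ * m := by
      rw [abs_mul, abs_of_nonneg hμ]; exact mul_le_mul_of_nonneg_left hca hμ
    have h3 := abs_sub (r - a * e) (μ * ca)
    have h4 := abs_sub r (a * e)
    linarith
  have pdeE : ∀ t, 0 < t → ∀ x ∈ interior UnitSquare,
      HasDerivAt (fun s => ut s x - u s x) (du * lapl (fun y => ut t y - u t y) x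
        + (-q t x - F * (ut t x - u t x) - μu * cellAvg M (fun y => ut t y - u t y) x)) t := by
    intro t ht x hx
    refine ((hpde_ut t ht x hx).sub (hpde_u t ht x hx)).congr_deriv ?_
    rw [lapl_sub (hreg_ut.2 t ht) (hreg_u.2 t ht) hx,
      cellAvg_sub hM (reg_cont hreg_ut ht) (reg_cont hreg_u ht) x]
    simp only [hq]
    ring
  have pdeF : ∀ t, 0 < t → ∀ x ∈ interior UnitSquare,
      HasDerivAt (fun s => vt s x - v s x) (dv * lapl (fun y => vt t y - v t y) x
        + (q t x - (F + k) * (vt t x - v t x) - μv * cellAvg M (fun y => vt t y - v t y) x))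
        t := by
    intro t ht x hx
    refine ((hpde_vt t ht x hx).sub (hpde_v t ht x hx)).congr_deriv ?_
    rw [lapl_sub (hreg_vt.2 t ht) (hreg_v.2 t ht) hx,
      cellAvg_sub hM (reg_cont hreg_vt ht) (reg_cont hreg_v ht) x]
    simp only [hq]
    ring
  have hc : 0 ≤ γ₀ * H ^ 2 := by positivity
  have hε0 : 0 < ε := by linarith
  have hcu : ε * μu * (γ₀ * H ^ 2) ≤ du := by
    have h1 : ε * μu * (γ₀ * H ^ 2) ≤ ε * max μu μv * (γ₀ * H ^ 2) :=
      mul_le_mul_of_nonneg_right (mul_le_mul_of_nonneg_left (le_max_left _ _) hε0.le) hc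
    have h2 := hcoer.trans (min_le_left _ _)
    linarith
  have hcv : ε * μv * (γ₀ * H ^ 2) ≤ dv := by
    have h1 : ε * μv * (γ₀ * H ^ 2) ≤ ε * max μu μv * (γ₀ * H ^ 2) :=
      mul_le_mul_of_nonneg_right (mul_le_mul_of_nonneg_left (le_max_right _ _) hε0.le) hc
    have h2 := hcoer.trans (min_le_right _ _)
    linarith
  have hg1 : γ + 2 * (vmax ^ 2 + 2 * vmax) ≤ F + μu * (1 - 1 / (4 * ε)) := by
    rw [hγdef, sub_add_cancel]; exact min_le_left _ _
  have hg2 : γ + 2 * (vmax ^ 2 + 2 * vmax) ≤ F + k + μv * (1 - 1 / (4 * ε)) := by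
    rw [hγdef, sub_add_cancel]; exact min_le_right _ _
  intro t ht
  refine gronwall_right
    (E := fun t => (∫ x in UnitSquare, (ut t x - u t x) ^ 2)
      + ∫ x in UnitSquare, (vt t x - v t x) ^ 2)
    (E' := fun t => (∫ x in UnitSquare, 2 * (ut t x - u t x) *
        (du * lapl (fun y => ut t y - u t y) x
        + (-q t x - F * (ut t x - u t x) - μu * cellAvg M (fun y => ut t y - u t y) x)))
      + ∫ x in UnitSquare, 2 * (vt t x - v t x) *
        (dv * lapl (fun y => vt t y - v t y) x
        + (q t x - (F + k) * (vt t x - v t x) - μv * cellAvg M (fun y => vt t y - v t y) x)))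
    ((energy_cont regE bE).add (energy_cont regF bF)) ?_ ?_ ht
  · intro s hs
    refine (energy_right_deriv (G := vmax ^ 2 + F * 1 + μu * 1) hdu hs regE nE
      (g := fun t x => -q t x - F * (ut t x - u t x)
        - μu * cellAvg M (fun y => ut t y - u t y) x) pdeE ?_ bE).add
      (energy_right_deriv (G := vmax ^ 2 + (F + k) * vmax + μv * vmax) hdv hs regF nF
      (g := fun t x => q t x - (F + k) * (vt t x - v t x)
        - μv * cellAvg M (fun y => vt t y - v t y) x) pdeF ?_ bF)
    · intro t ht x hx
      refine gbound hF.le hμu ?_ (bE t ht.le x (int_us hx)) (cellAvg_bound hM (bE t ht.le) x)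
      rw [abs_neg]; exact bq t ht.le x (int_us hx)
    · intro t ht x hx
      exact gbound (by positivity) hμv (bq t ht.le x (int_us hx)) (bF t ht.le x (int_us hx))
        (cellAvg_bound hM (bF t ht.le) x)
  · intro s hs
    have cE := reg_cont regE hs
    have cF := reg_cont regF hs
    have h1 := comp_energy hM hc hμu hε0 hcu hinterp (regE.2 s hs) (nE s hs) (cq s hs).neg
      (a := F)
    have h2 := comp_energy hM hc hμv hε0 hcv hinterp (regF.2 s hs) (nF s hs) (cq s hs)
      (a := F + k)
    simp only [Pi.neg_apply] at h1
    have i1 : IntegrableOn (fun x => (ut s x - u s x) * -q s x) UnitSquare :=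
      us_integrable (cE.mul (cq s hs).neg)
    have i2 : IntegrableOn (fun x => (vt s x - v s x) * q s x) UnitSquare :=
      us_integrable (cF.mul (cq s hs))
    have i3 : IntegrableOn (fun x => (ut s x - u s x) ^ 2) UnitSquare :=
      us_integrable (cE.pow 2)
    have i4 : IntegrableOn (fun x => (vt s x - v s x) ^ 2) UnitSquare :=
      us_integrable (cF.pow 2)
    have h3 : (∫ x in UnitSquare, (ut s x - u s x) * -q s x)
        + (∫ x in UnitSquare, (vt s x - v s x) * q s x)
        ≤ 2 * (vmax ^ 2 + 2 * vmax) * ((∫ x in UnitSquare, (ut s x - u s x) ^ 2)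
          + ∫ x in UnitSquare, (vt s x - v s x) ^ 2) := by
      rw [← integral_add i1 i2, ← integral_add i3 i4, ← integral_const_mul]
      refine us_integral_mono (i1.add i2) ((i3.add i4).const_mul _) fun x hx => ?_
      have hx' := int_us hx
      have := nonlin (a := ut s x) hvmax (hub s hs.le x hx') (hvb s hs.le x hx')
        (hvtb s hs.le x hx')
      simp only [hq, Pi.add_apply]
      linarith
    have e0 : 0 ≤ ∫ x in UnitSquare, (ut s x - u s x) ^ 2 :=
      setIntegral_nonneg us_meas fun x _ => sq_nonneg _
    have f0 : 0 ≤ ∫ x in UnitSquare, (vt s x - v s x) ^ 2 :=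
      setIntegral_nonneg us_meas fun x _ => sq_nonneg _
    have m1 := mul_le_mul_of_nonneg_right hg1 e0
    have m2 := mul_le_mul_of_nonneg_right hg2 f0
    linarith
end

section
/- Nonlinear estimate (Lemma 4.7). Assume ‖ṽ‖_{L∞} ≤ v_max, ‖v‖_{L∞} ≤ v_max, ‖ũ‖_{L∞} ≤ 1 and ‖u‖_{L∞} ≤ 1. Then, with e := ũ − u and f := ṽ − v, one has ∫_D (ũ ṽ² − u v²)(f − e) ≤ C_NL (‖e‖_{L²}² + ‖f‖_{L²}²), where C_NL := 2(v_max² + 2 v_max). -/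
open MeasureTheory

/-- Nonlinear estimate (Lemma 4.7). -/
theorem nonlinear_estimate (D : Set (ℝ × ℝ)) (hD : MeasurableSet D)
    (hDb : Bornology.IsBounded D)
    (u ut v vt : ℝ × ℝ → ℝ)
    (hum : Measurable u) (hutm : Measurable ut) (hvm : Measurable v) (hvtm : Measurable vt)
    (vmax : ℝ) (hvmax : 0 ≤ vmax)
    (hu : ∀ᵐ x ∂(volume.restrict D), |u x| ≤ 1)
    (hut : ∀ᵐ x ∂(volume.restrict D), |ut x| ≤ 1)
    (hv : ∀ᵐ x ∂(volume.restrict D), |v x| ≤ vmax)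
    (hvt : ∀ᵐ x ∂(volume.restrict D), |vt x| ≤ vmax) :
    (∫ x in D, (ut x * (vt x) ^ 2 - u x * (v x) ^ 2) * ((vt x - v x) - (ut x - u x))) ≤
      2 * (vmax ^ 2 + 2 * vmax) *
        ((∫ x in D, (ut x - u x) ^ 2) + ∫ x in D, (vt x - v x) ^ 2) := by
  have hfin : IsFiniteMeasure (volume.restrict D) :=
    ⟨by rw [Measure.restrict_apply_univ]; exact hDb.measure_lt_top⟩
  have he : Integrable (fun x => (ut x - u x) ^ 2) (volume.restrict D) := by
    refine Integrable.of_bound (C := (2 : ℝ) ^ 2)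
      ((hutm.sub hum).pow_const 2).aestronglyMeasurable ?_
    filter_upwards [hu, hut] with x h1 h2
    rw [Real.norm_eq_abs, abs_pow]
    have := abs_sub (ut x) (u x)
    gcongr
    linarith
  have hf : Integrable (fun x => (vt x - v x) ^ 2) (volume.restrict D) := by
    refine Integrable.of_bound (C := (2 * vmax) ^ 2)
      ((hvtm.sub hvm).pow_const 2).aestronglyMeasurable ?_
    filter_upwards [hv, hvt] with x h1 h2
    rw [Real.norm_eq_abs, abs_pow]
    have := abs_sub (vt x) (v x)
    gcongr
    linarith
  have hG := (he.add hf).const_mul (2 * (vmax ^ 2 + 2 * vmax))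
  have hb : ∀ᵐ x ∂(volume.restrict D),
      ‖(ut x * (vt x) ^ 2 - u x * (v x) ^ 2) * ((vt x - v x) - (ut x - u x))‖ ≤
        2 * (vmax ^ 2 + 2 * vmax) * ((ut x - u x) ^ 2 + (vt x - v x) ^ 2) := by
    filter_upwards [hu, hv, hvt] with x h1 h2 h3
    rw [Real.norm_eq_abs, abs_mul]
    have hA : |ut x * (vt x) ^ 2 - u x * (v x) ^ 2| ≤
        vmax ^ 2 * |ut x - u x| + 2 * vmax * |vt x - v x| := by
      have e1 : ut x * (vt x) ^ 2 - u x * (v x) ^ 2 =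
        (vt x) ^ 2 * (ut x - u x) + (u x * (vt x + v x)) * (vt x - v x) := by ring
      rw [e1]
      refine (abs_add_le _ _).trans ?_
      rw [abs_mul, abs_mul, abs_pow, abs_mul]
      have h4 : |vt x + v x| ≤ 2 * vmax := (abs_add_le _ _).trans (by linarith)
      have h5 : |u x| * |vt x + v x| ≤ 2 * vmax := by
        calc _ ≤ 1 * (2 * vmax) := by gcongr
          _ = _ := one_mul _
      gcongr
    have hB : |(vt x - v x) - (ut x - u x)| ≤ |ut x - u x| + |vt x - v x| :=
      (abs_sub _ _).trans (by linarith)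
    rw [← sq_abs (ut x - u x), ← sq_abs (vt x - v x)]
    have ha := abs_nonneg (ut x - u x)
    have hc := abs_nonneg (vt x - v x)
    generalize |ut x - u x| = a at *
    generalize |vt x - v x| = c at *
    have hK : 0 ≤ vmax ^ 2 + 2 * vmax := by positivity
    calc _ ≤ (vmax ^ 2 * a + 2 * vmax * c) * (a + c) := by gcongr
      _ ≤ (vmax ^ 2 + 2 * vmax) * (a + c) * (a + c) := by
        gcongr
        nlinarith [mul_nonneg (sq_nonneg vmax) hc, mul_nonneg hvmax ha]
      _ ≤ _ := by nlinarith [mul_nonneg hK (sq_nonneg (a - c))]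
  have hI := hG.mono' (Measurable.aestronglyMeasurable (by fun_prop)) hb
  rw [← integral_add he hf, ← integral_const_mul]
  refine integral_mono_ae hI hG ?_
  filter_upwards [hb] with x hx
  exact (le_abs_self _).trans hx
end

section
/- Discrete interpolation (Poincaré) estimate for block averaging. There exists a constant γ₀ > 0 such that for all integers m, M ≥ 1 (with N = mM, h = 1/N, H = mh = 1/M) and every fine-grid function w: ‖w − 𝓘_H w‖_h² ≤ γ₀ H² ‖∇w‖_h². -/
open Finset

lemma aux_split (m M : ℕ) (f : ℕ → ℝ) :
    ∑ a ∈ range (m * M), f a = ∑ I ∈ range M, ∑ i ∈ range m, f (m * I + i) := by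
  induction M with
  | zero => simp
  | succ M ih => rw [Nat.mul_succ, Finset.sum_range_add, ih, Finset.sum_range_succ]

lemma aux_pick (m M I : ℕ) (hm : 1 ≤ m) (hI : I < M) (f : ℕ → ℝ) :
    ∑ a ∈ range (m * M), (if a / m = I then f a else 0) = ∑ i ∈ range m, f (m * I + i) := by
  rw [aux_split]
  have h : ∀ J ∈ range M, ∑ i ∈ range m, (if (m * J + i) / m = I then f (m * J + i) else 0)
      = if J = I then ∑ i ∈ range m, f (m * I + i) else 0 := by
    intro J _
    have h2 : ∀ i ∈ range m, (if (m * J + i) / m = I then f (m * J + i) else 0)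
        = if J = I then f (m * I + i) else 0 := by
      intro i hi
      have : (m * J + i) / m = J := by
        rw [Nat.mul_add_div (by omega), Nat.div_eq_of_lt (mem_range.1 hi)]; simp
      rw [this]
      split_ifs with h
      · rw [h]
      · rfl
    rw [Finset.sum_congr rfl h2]
    split_ifs <;> simp
  rw [Finset.sum_congr rfl h]
  simp [hI]

lemma aux_1d (m : ℕ) (f : ℕ → ℝ) (i k : ℕ) (hi : i < m) (hk : k < m) :
    (f i - f k) ^ 2 ≤ m * ∑ t ∈ range (m - 1), (f (t + 1) - f t) ^ 2 := by
  wlog h : k ≤ i generalizing i k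
  · have := this k i hk hi (by omega)
    calc (f i - f k) ^ 2 = (f k - f i) ^ 2 := by ring
      _ ≤ _ := this
  have h1 : f i - f k = ∑ t ∈ Ico k i, (f (t + 1) - f t) := (Finset.sum_Ico_sub f h).symm
  rw [h1]
  have hs : ∑ t ∈ Ico k i, (f (t + 1) - f t) ^ 2 ≤ ∑ t ∈ range (m - 1), (f (t + 1) - f t) ^ 2 := by
    apply Finset.sum_le_sum_of_subset_of_nonneg
    · intro t ht
      simp only [mem_Ico, mem_range] at *
      omega
    · intros; positivity
  have hc : ((Ico k i).card : ℝ) ≤ m := by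
    rw [Nat.card_Ico]; exact_mod_cast (by omega)
  calc _ ≤ ((Ico k i).card : ℝ) * ∑ t ∈ Ico k i, (f (t + 1) - f t) ^ 2 := sq_sum_le_card_mul_sum_sq
    _ ≤ _ := by gcongr

/-- Poincare inequality on one block. -/
lemma aux_block (m : ℕ) (hm : 1 ≤ m) (u : ℕ → ℕ → ℝ) :
    ∑ i ∈ range m, ∑ j ∈ range m,
      (u i j - (1 / (m : ℝ) ^ 2) * ∑ k ∈ range m, ∑ l ∈ range m, u k l) ^ 2
    ≤ 2 * (m : ℝ) ^ 2 * (∑ i ∈ range m, ∑ t ∈ range (m - 1), (u i (t + 1) - u i t) ^ 2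
        + ∑ j ∈ range m, ∑ t ∈ range (m - 1), (u (t + 1) j - u t j) ^ 2) := by
  have hm0 : (0 : ℝ) < m := by exact_mod_cast hm
  set A := ∑ i ∈ range m, ∑ t ∈ range (m - 1), (u i (t + 1) - u i t) ^ 2 with hA
  set B := ∑ j ∈ range m, ∑ t ∈ range (m - 1), (u (t + 1) j - u t j) ^ 2 with hB
  have key : ∀ i ∈ range m, ∀ j ∈ range m,
      (u i j - (1 / (m : ℝ) ^ 2) * ∑ k ∈ range m, ∑ l ∈ range m, u k l) ^ 2
      ≤ 2 * A + 2 * m * ∑ t ∈ range (m - 1), (u (t + 1) j - u t j) ^ 2 := by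
    intro i hi j hj
    set S := ∑ t ∈ range (m - 1), (u (t + 1) j - u t j) ^ 2 with hS
    have e : u i j - (1 / (m : ℝ) ^ 2) * ∑ k ∈ range m, ∑ l ∈ range m, u k l
        = (1 / (m : ℝ) ^ 2) * ∑ p ∈ range m ×ˢ range m, (u i j - u p.1 p.2) := by
      rw [Finset.sum_sub_distrib, Finset.sum_product (f := fun p : ℕ × ℕ => u p.1 p.2)]
      simp only [sum_const, card_product, card_range, nsmul_eq_mul]
      push_cast
      field_simp
    have cs : (∑ p ∈ range m ×ˢ range m, (u i j - u p.1 p.2)) ^ 2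
        ≤ (m : ℝ) ^ 2 * ∑ p ∈ range m ×ˢ range m, (u i j - u p.1 p.2) ^ 2 := by
      have := sq_sum_le_card_mul_sum_sq (s := range m ×ˢ range m)
        (f := fun p : ℕ × ℕ => u i j - u p.1 p.2)
      simp only [card_product, card_range] at this
      push_cast at this
      rwa [← pow_two (m : ℝ)] at this
    have pt : ∑ p ∈ range m ×ˢ range m, (u i j - u p.1 p.2) ^ 2
        ≤ (m : ℝ) ^ 2 * (2 * A + 2 * m * S) := by
      rw [Finset.sum_product]
      calc ∑ k ∈ range m, ∑ l ∈ range m, (u i j - u k l) ^ 2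
          ≤ ∑ k ∈ range m, ∑ l ∈ range m, (2 * (m * S)
            + 2 * (m * ∑ t ∈ range (m - 1), (u k (t + 1) - u k t) ^ 2)) := by
            apply Finset.sum_le_sum; intro k hk
            apply Finset.sum_le_sum; intro l hl
            have h1 := aux_1d m (fun t => u t j) i k (mem_range.1 hi) (mem_range.1 hk)
            have h2 := aux_1d m (fun t => u k t) j l (mem_range.1 hj) (mem_range.1 hl)
            rw [← hS] at h1
            nlinarith [sq_nonneg ((u i j - u k j) - (u k j - u k l))]
        _ = (m : ℝ) ^ 2 * (2 * A + 2 * m * S) := by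
            simp only [sum_const, card_range, nsmul_eq_mul]
            rw [← Finset.mul_sum, Finset.sum_add_distrib, ← Finset.mul_sum, ← Finset.mul_sum,
              ← Finset.mul_sum, ← Finset.mul_sum, ← hA]
            simp only [sum_const, card_range, nsmul_eq_mul]
            ring
    rw [e, mul_pow]
    calc _ ≤ (1 / (m : ℝ) ^ 2) ^ 2 * ((m : ℝ) ^ 2 * ((m : ℝ) ^ 2 * (2 * A + 2 * m * S))) := by
          gcongr; exact cs.trans (by gcongr)
      _ = _ := by field_simp
  calc _ ≤ ∑ i ∈ range m, ∑ j ∈ range m,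
        (2 * A + 2 * m * ∑ t ∈ range (m - 1), (u (t + 1) j - u t j) ^ 2) :=
        Finset.sum_le_sum fun i hi => Finset.sum_le_sum fun j hj => key i hi j hj
    _ = _ := by
        simp only [sum_const, card_range, nsmul_eq_mul]
        rw [Finset.sum_add_distrib, ← Finset.mul_sum, ← Finset.mul_sum, ← hB]
        simp only [sum_const, card_range, nsmul_eq_mul]
        ring

lemma aux_pairsum (N : ℕ) (F : ℕ → ℕ → ℝ) :
    ∑ K : Fin N × Fin N, F K.1 K.2 = ∑ a ∈ range N, ∑ b ∈ range N, F a b := by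
  rw [Fintype.sum_prod_type, Finset.sum_range]
  refine Finset.sum_congr rfl fun a _ => ?_
  rw [Finset.sum_range]

lemma aux_split_le (m M : ℕ) (g : ℕ → ℝ) (hg : ∀ t, 0 ≤ g t) :
    ∑ J ∈ range M, ∑ t ∈ range (m - 1), g (m * J + t)
      ≤ ∑ b ∈ range (m * M), (if b + 1 < m * M then g b else 0) := by
  rw [aux_split]
  apply Finset.sum_le_sum; intro J hJ
  have : ∀ t ∈ range (m - 1), g (m * J + t)
      = if m * J + t + 1 < m * M then g (m * J + t) else 0 := by
    intro t ht
    have h1 : m * (J + 1) ≤ m * M := Nat.mul_le_mul_left _ (mem_range.1 hJ)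
    have h2 := mem_range.1 ht
    rw [Nat.mul_succ] at h1
    rw [if_pos (by omega)]
  rw [Finset.sum_congr rfl this]
  apply Finset.sum_le_sum_of_subset_of_nonneg
  · intro t ht
    simp only [mem_range] at *
    omega
  · intro t _ _
    split_ifs
    · exact hg _
    · exact le_rfl

lemma aux_grad (N : ℕ) (W : ℕ → ℕ → ℝ) :
    (∑ a ∈ range N, ∑ b ∈ range N, (if b + 1 < N then (W a (b + 1) - W a b) ^ 2 else 0))
    + (∑ a ∈ range N, ∑ b ∈ range N, (if a + 1 < N then (W (a + 1) b - W a b) ^ 2 else 0))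
    ≤ 2 * gridGradNormSq N (fun K => W K.1 K.2) := by
  unfold gridGradNormSq gridGradIP
  rw [← mul_assoc, show (2 : ℝ) * (1 / 2) = 1 by norm_num, one_mul]
  rw [← aux_pairsum N (fun a b => if b + 1 < N then (W a (b + 1) - W a b) ^ 2 else 0),
    ← aux_pairsum N (fun a b => if a + 1 < N then (W (a + 1) b - W a b) ^ 2 else 0),
    ← Finset.sum_add_distrib]
  apply Finset.sum_le_sum
  rintro ⟨a, b⟩ -
  have h1 : (if (b : ℕ) + 1 < N then (W a (b + 1) - W a b) ^ 2 else 0)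
      ≤ ∑ L : Fin N × Fin N, if a = L.1 ∧ (b : ℕ) + 1 = L.2 then
        (W a b - W L.1 L.2) * (W a b - W L.1 L.2) else 0 := by
    have hn : ∀ L ∈ (univ : Finset (Fin N × Fin N)), 0 ≤ if a = L.1 ∧ (b : ℕ) + 1 = L.2 then
        (W a b - W L.1 L.2) * (W a b - W L.1 L.2) else 0 := by
      intro L _
      split_ifs
      · exact mul_self_nonneg _
      · exact le_rfl
    split_ifs with h
    · refine le_trans (le_of_eq ?_) (Finset.single_le_sum hn (mem_univ (a, ⟨b + 1, h⟩)))
      simp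
      ring
    · exact Finset.sum_nonneg hn
  have h2 : (if (a : ℕ) + 1 < N then (W (a + 1) b - W a b) ^ 2 else 0)
      ≤ ∑ L : Fin N × Fin N, if b = L.2 ∧ (a : ℕ) + 1 = L.1 then
        (W a b - W L.1 L.2) * (W a b - W L.1 L.2) else 0 := by
    have hn : ∀ L ∈ (univ : Finset (Fin N × Fin N)), 0 ≤ if b = L.2 ∧ (a : ℕ) + 1 = L.1 then
        (W a b - W L.1 L.2) * (W a b - W L.1 L.2) else 0 := by
      intro L _
      split_ifs
      · exact mul_self_nonneg _
      · exact le_rfl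
    split_ifs with h
    · refine le_trans (le_of_eq ?_) (Finset.single_le_sum hn (mem_univ (⟨a + 1, h⟩, b)))
      simp
      ring
    · exact Finset.sum_nonneg hn
  refine (add_le_add h1 h2).trans ?_
  rw [← Finset.sum_add_distrib]
  apply Finset.sum_le_sum
  rintro ⟨c, d⟩ -
  have hp := mul_self_nonneg (W a b - W c d)
  dsimp only
  by_cases p : a = c ∧ (b : ℕ) + 1 = d
  · have q : ¬ (b = d ∧ (a : ℕ) + 1 = c) := by
      rintro ⟨q, -⟩
      rw [q] at p
      omega
    rw [if_pos p, if_neg q, if_pos (show adjCells (a, b) (c, d) from Or.inl ⟨p.1, Or.inl p.2⟩), add_zero]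
  · rw [if_neg p, zero_add]
    by_cases q : b = d ∧ (a : ℕ) + 1 = c
    · rw [if_pos q, if_pos (show adjCells (a, b) (c, d) from Or.inr ⟨q.1, Or.inl q.2⟩)]
    · rw [if_neg q]
      split_ifs
      · exact hp
      · exact le_rfl

lemma aux_obs (m M I J : ℕ) (hm : 1 ≤ m) (hI : I < M) (hJ : J < M) (W : ℕ → ℕ → ℝ) :
    ∑ a ∈ range (m * M), ∑ b ∈ range (m * M), (if a / m = I ∧ b / m = J then W a b else 0)
     = ∑ k ∈ range m, ∑ l ∈ range m, W (m * I + k) (m * J + l) := by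
  rw [← aux_pick m M I hm hI (fun a => ∑ l ∈ range m, W a (m * J + l))]
  refine Finset.sum_congr rfl fun a _ => ?_
  rw [← aux_pick m M J hm hJ (fun b => W a b)]
  by_cases h : a / m = I <;> simp [h]

lemma aux_main (m M : ℕ) (hm : 1 ≤ m) (W : ℕ → ℕ → ℝ) :
    ∑ a ∈ range (m * M), ∑ b ∈ range (m * M), (W a b - (1 / (m : ℝ) ^ 2) *
      ∑ c ∈ range (m * M), ∑ d ∈ range (m * M),
        (if c / m = a / m ∧ d / m = b / m then W c d else 0)) ^ 2
    ≤ 4 * (m : ℝ) ^ 2 * gridGradNormSq (m * M) (fun K => W K.1 K.2) := by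
  have hg := aux_grad (m * M) W
  have e1 : ∑ I ∈ range M, ∑ J ∈ range M, ∑ i ∈ range m, ∑ t ∈ range (m - 1),
      (W (m * I + i) (m * J + (t + 1)) - W (m * I + i) (m * J + t)) ^ 2 ≤
      ∑ a ∈ range (m * M), ∑ b ∈ range (m * M),
        (if b + 1 < m * M then (W a (b + 1) - W a b) ^ 2 else 0) := by
    rw [aux_split m M (fun a => ∑ b ∈ range (m * M),
        (if b + 1 < m * M then (W a (b + 1) - W a b) ^ 2 else 0))]
    apply Finset.sum_le_sum; intro I _
    rw [Finset.sum_comm]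
    apply Finset.sum_le_sum; intro i _
    exact aux_split_le m M (fun b => (W (m * I + i) (b + 1) - W (m * I + i) b) ^ 2)
      (fun _ => sq_nonneg _)
  have e2 : ∑ I ∈ range M, ∑ J ∈ range M, ∑ j ∈ range m, ∑ t ∈ range (m - 1),
      (W (m * I + (t + 1)) (m * J + j) - W (m * I + t) (m * J + j)) ^ 2 ≤
      ∑ a ∈ range (m * M), ∑ b ∈ range (m * M),
        (if a + 1 < m * M then (W (a + 1) b - W a b) ^ 2 else 0) := by
    rw [Finset.sum_comm, Finset.sum_comm (s := range (m * M)),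
      aux_split m M (fun b => ∑ a ∈ range (m * M),
        (if a + 1 < m * M then (W (a + 1) b - W a b) ^ 2 else 0))]
    apply Finset.sum_le_sum; intro J _
    rw [Finset.sum_comm]
    apply Finset.sum_le_sum; intro j _
    exact aux_split_le m M (fun a => (W (a + 1) (m * J + j) - W a (m * J + j)) ^ 2)
      (fun _ => sq_nonneg _)
  calc _ = ∑ I ∈ range M, ∑ J ∈ range M, ∑ i ∈ range m, ∑ j ∈ range m,
        (W (m * I + i) (m * J + j) - (1 / (m : ℝ) ^ 2) *
          ∑ k ∈ range m, ∑ l ∈ range m, W (m * I + k) (m * J + l)) ^ 2 := by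
        rw [aux_split]
        refine Finset.sum_congr rfl fun I hI => ?_
        rw [Finset.sum_comm' (s := range M) (t' := range m) (s' := fun _ => range M)
          (t := fun _ => range m) (by intros; tauto)]
        refine Finset.sum_congr rfl fun i hi => ?_
        rw [aux_split]
        refine Finset.sum_congr rfl fun J hJ => ?_
        refine Finset.sum_congr rfl fun j hj => ?_
        have d1 : (m * I + i) / m = I := by
          rw [Nat.mul_add_div (by omega), Nat.div_eq_of_lt (mem_range.1 hi)]; simp
        have d2 : (m * J + j) / m = J := by
          rw [Nat.mul_add_div (by omega), Nat.div_eq_of_lt (mem_range.1 hj)]; simp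
        rw [d1, d2, aux_obs m M I J hm (mem_range.1 hI) (mem_range.1 hJ)]
    _ ≤ ∑ I ∈ range M, ∑ J ∈ range M, 2 * (m : ℝ) ^ 2 *
        (∑ i ∈ range m, ∑ t ∈ range (m - 1),
          (W (m * I + i) (m * J + (t + 1)) - W (m * I + i) (m * J + t)) ^ 2
        + ∑ j ∈ range m, ∑ t ∈ range (m - 1),
          (W (m * I + (t + 1)) (m * J + j) - W (m * I + t) (m * J + j)) ^ 2) := by
        apply Finset.sum_le_sum; intro I _
        apply Finset.sum_le_sum; intro J _
        exact aux_block m hm (fun i j => W (m * I + i) (m * J + j))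
    _ ≤ _ := by
        simp only [← Finset.mul_sum, Finset.sum_add_distrib]
        have : (0 : ℝ) ≤ 2 * (m : ℝ) ^ 2 := by positivity
        calc _ ≤ 2 * (m : ℝ) ^ 2 * (2 * gridGradNormSq (m * M) (fun K => W K.1 K.2)) :=
              mul_le_mul_of_nonneg_left ((add_le_add e1 e2).trans hg) this
          _ = _ := by ring

/-- Discrete interpolation (Poincaré) estimate for block averaging. -/
theorem discrete_interpolation_estimate :
    ∃ γ₀ : ℝ, 0 < γ₀ ∧ ∀ (m M N : ℕ), 1 ≤ m → 1 ≤ M → N = m * M →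
      ∀ w : Fin N × Fin N → ℝ,
        gridNormSq N (w - obsAvg N m w) ≤ γ₀ * ((1 : ℝ) / M) ^ 2 * gridGradNormSq N w := by
  refine ⟨4, by norm_num, ?_⟩
  intro m M N hm hM hN w
  subst hN
  have hm0 : (0 : ℝ) < m := by exact_mod_cast hm
  have hM0 : (0 : ℝ) < M := by exact_mod_cast hM
  obtain ⟨W, rfl⟩ : ∃ W : ℕ → ℕ → ℝ, w = fun K => W K.1 K.2 :=
    ⟨fun a b => if h : a < m * M ∧ b < m * M then w (⟨a, h.1⟩, ⟨b, h.2⟩) else 0, by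
      funext K
      simp⟩
  have h := aux_main m M hm W
  have e : gridNormSq (m * M) ((fun K => W K.1 K.2) - obsAvg (m * M) m (fun K => W K.1 K.2))
      = ((1 : ℝ) / (m * M : ℕ)) ^ 2 * ∑ a ∈ range (m * M), ∑ b ∈ range (m * M),
      (W a b - (1 / (m : ℝ) ^ 2) * ∑ c ∈ range (m * M), ∑ d ∈ range (m * M),
        (if c / m = a / m ∧ d / m = b / m then W c d else 0)) ^ 2 := by
    unfold gridNormSq gridIP obsAvg
    rw [← aux_pairsum (m * M) (fun a b => (W a b - (1 / (m : ℝ) ^ 2) *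
      ∑ c ∈ range (m * M), ∑ d ∈ range (m * M),
        (if c / m = a / m ∧ d / m = b / m then W c d else 0)) ^ 2)]
    congr 1
    refine Finset.sum_congr rfl fun K _ => ?_
    rw [← aux_pairsum (m * M)
      (fun c d => if c / m = (K.1 : ℕ) / m ∧ d / m = (K.2 : ℕ) / m then W c d else 0)]
    simp only [Pi.sub_apply]
    ring
  rw [e]
  calc _ ≤ ((1 : ℝ) / (m * M : ℕ)) ^ 2 *
        (4 * (m : ℝ) ^ 2 * gridGradNormSq (m * M) (fun K => W K.1 K.2)) := by gcongr
    _ = _ := by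
      push_cast
      field_simp
end

section
/- Discrete nonlinear estimate (the bound on the term III_n in the proof of Theorem 4.8). Let v_max ≥ 0 and let u, ũ, v, ṽ be fine-grid functions with |u_K| ≤ 1, |v_K| ≤ v_max and |ṽ_K| ≤ v_max for all cells K. Set e := ũ − u and f := ṽ − v, and let e′, f′ be arbitrary fine-grid functions. Then 2(ũ ṽ² − u v², f′ − e′)_h ≤ C_NL ( ‖e′ − e‖_h² + ‖f′ − f‖_h² ) + 2 C_NL ( ‖e′‖_h² + ‖f′‖_h² ), where C_NL := 2(v_max² + 2 v_max). -/
/-- Pointwise version of the estimate. -/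
theorem pointwise_nonlinear_estimate (V u ut v vt x y : ℝ)
    (hu : |u| ≤ 1) (hv : |v| ≤ V) (hvt : |vt| ≤ V) :
    2 * ((ut * vt ^ 2 - u * v ^ 2) * (y - x)) ≤
      2 * (V ^ 2 + 2 * V) * ((x - (ut - u)) * (x - (ut - u)) + (y - (vt - v)) * (y - (vt - v)))
        + 2 * (2 * (V ^ 2 + 2 * V)) * (x * x + y * y) := by
  have hV : 0 ≤ V := (abs_nonneg v).trans hv
  obtain ⟨e, he⟩ : ∃ e, e = ut - u := ⟨_, rfl⟩
  obtain ⟨f, hf⟩ : ∃ f, f = vt - v := ⟨_, rfl⟩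
  rw [← he, ← hf]
  have key : (ut * vt ^ 2 - u * v ^ 2) * (y - x)
      = vt ^ 2 * (e * (y - x)) + (u * (vt + v)) * (f * (y - x)) := by
    rw [he, hf]; ring
  obtain ⟨S, hS⟩ : ∃ S, S = (x - e) ^ 2 + (y - f) ^ 2 + 2 * x ^ 2 + 2 * y ^ 2 := ⟨_, rfl⟩
  have hS0 : 0 ≤ S := by rw [hS]; positivity
  have h1 : |e * (y - x)| ≤ S := by
    rw [hS, abs_le]
    constructor <;>
      nlinarith [sq_nonneg ((x - e) - y), sq_nonneg ((x - e) + y), sq_nonneg ((x - e) - x),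
        sq_nonneg ((x - e) + x), sq_nonneg (x - y), sq_nonneg (x + y), sq_nonneg (y - f),
        sq_nonneg x, sq_nonneg y]
  have h2 : |f * (y - x)| ≤ S := by
    rw [hS, abs_le]
    constructor <;>
      nlinarith [sq_nonneg ((y - f) - y), sq_nonneg ((y - f) + y), sq_nonneg ((y - f) - x),
        sq_nonneg ((y - f) + x), sq_nonneg (x - y), sq_nonneg (x + y), sq_nonneg (x - e),
        sq_nonneg x, sq_nonneg y]
  have ha : |vt ^ 2| ≤ V ^ 2 := by
    rw [abs_pow]; exact pow_le_pow_left₀ (abs_nonneg _) hvt 2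
  have hb : |u * (vt + v)| ≤ 2 * V := by
    rw [abs_mul]
    have h3 : |vt + v| ≤ 2 * V := (abs_add_le _ _).trans (by linarith)
    calc |u| * |vt + v| ≤ 1 * (2 * V) := mul_le_mul hu h3 (abs_nonneg _) zero_le_one
      _ = 2 * V := one_mul _
  have h4 : vt ^ 2 * (e * (y - x)) ≤ V ^ 2 * S := by
    refine (le_abs_self _).trans ?_
    rw [abs_mul]
    exact mul_le_mul ha h1 (abs_nonneg _) (by positivity)
  have h5 : (u * (vt + v)) * (f * (y - x)) ≤ 2 * V * S := by
    refine (le_abs_self _).trans ?_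
    rw [abs_mul]
    exact mul_le_mul hb h2 (abs_nonneg _) (by positivity)
  rw [key]
  calc _ ≤ 2 * (V ^ 2 * S + 2 * V * S) := by linarith
    _ = _ := by rw [hS]; ring

/-- Discrete nonlinear estimate (bound on the term `III_n` in the proof of Theorem 4.8). -/
theorem discrete_nonlinear_estimate (N : ℕ) (vmax : ℝ) (hvmax : 0 ≤ vmax)
    (u ut v vt e' f' : Fin N × Fin N → ℝ)
    (hu : ∀ K, |u K| ≤ 1) (hv : ∀ K, |v K| ≤ vmax) (hvt : ∀ K, |vt K| ≤ vmax) :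
    2 * gridIP N (fun K => ut K * (vt K) ^ 2 - u K * (v K) ^ 2) (f' - e') ≤
      2 * (vmax ^ 2 + 2 * vmax) * (gridNormSq N (e' - (ut - u)) + gridNormSq N (f' - (vt - v)))
        + 2 * (2 * (vmax ^ 2 + 2 * vmax)) * (gridNormSq N e' + gridNormSq N f') := by
  have h := mul_le_mul_of_nonneg_left
    (Finset.sum_le_sum fun K (_ : K ∈ (Finset.univ : Finset (Fin N × Fin N))) =>
      pointwise_nonlinear_estimate vmax (u K) (ut K) (v K) (vt K) (e' K) (f' K)
        (hu K) (hv K) (hvt K)) (sq_nonneg ((1 : ℝ) / N))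
  simp only [Finset.sum_add_distrib, ← Finset.mul_sum] at h
  simp only [gridNormSq, gridIP, Pi.sub_apply]
  linarith
end
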